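/- For every m ≥ 2 and every n ≥ 2m + 2 there exist real coefficients A_{i₁…i_{2m}} whose symbol Q satisfies Q(ξ) ≥ λ|ξ|^{2m} for some λ > 0, such that every function K : ℝⁿ → ℝ which is locally integrable, continuous on ℝⁿ\{0}, homogeneous of degree 2m−n, and a fundamental solution of the associated operator L attains both signs: there exist y, z ∈ ℝⁿ\{0} with K(y) > 0 and K(z) < 0 (so by homogeneity K changes sign in every punctured neighbourhood of 0). -/

import Mathlib

open MeasureTheory RealInnerProductSpace

noncomputable section

/-- ℝⁿ as a Euclidean space. -/
abbrev En (n : ℕ) : Type := EuclideanSpace ℝ (Fin n)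

/-- The `i`-th standard basis vector of ℝⁿ. -/
def stdB (n : ℕ) (i : Fin n) : En n := EuclideanSpace.single i 1

/-- The symbol Q(ξ) = Σ_{i₁,…,i_{2m}} A_{i₁…i_{2m}} ξ_{i₁}⋯ξ_{i_{2m}}. -/
def symbolQ (n m : ℕ) (A : (Fin (2*m) → Fin n) → ℝ) (ξ : En n) : ℝ :=
  ∑ i : Fin (2*m) → Fin n, A i * ∏ j, ξ (i j)

/-- The constant-coefficient operator
(Lψ)(x) = (−1)^m Σ A_{i₁…i_{2m}} ∂_{i₁}⋯∂_{i_{2m}} ψ(x). -/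
def opL (n m : ℕ) (A : (Fin (2*m) → Fin n) → ℝ) (ψ : En n → ℝ) (x : En n) : ℝ :=
  (-1 : ℝ)^m * ∑ i : Fin (2*m) → Fin n,
    A i * iteratedFDeriv ℝ (2*m) ψ x (fun j => stdB n (i j))

/-- K is a fundamental solution of L: ∫ K(y) (Lψ)(y) dy = ψ(0) for all ψ ∈ C_c^∞. -/
def IsFundamentalSolution (n m : ℕ) (A : (Fin (2*m) → Fin n) → ℝ) (K : En n → ℝ) : Prop :=
  ∀ ψ : En n → ℝ, ContDiff ℝ (⊤ : ℕ∞) ψ → HasCompactSupport ψ →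
    ∫ y, K y * opL n m A ψ y = ψ 0

/-- K is homogeneous of degree a: K(σx) = |σ|^a K(x) for σ ≠ 0, x ≠ 0. -/
def HomogeneousDeg (n : ℕ) (a : ℝ) (K : En n → ℝ) : Prop :=
  ∀ σ : ℝ, σ ≠ 0 → ∀ x : En n, x ≠ 0 → K (σ • x) = |σ| ^ a * K x

/-- The Euclidean Laplacian Δf(x) = Σ_i ∂²f/∂x_i²(x). -/
def lap (n : ℕ) (f : En n → ℝ) (x : En n) : ℝ :=
  ∑ i : Fin n, iteratedFDeriv ℝ 2 f x (fun _ => stdB n i)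

/-- The point (x′, t) ∈ ℝ^{d} × ℝ = ℝ^{d+1}. -/
def snocVec (d : ℕ) (x' : En d) (t : ℝ) : En (d+1) :=
  (EuclideanSpace.equiv (Fin (d+1)) ℝ).symm (Fin.snoc (fun i => x' i) t)


theorem sgn_le_inf (k : ℕ) : ((k : ℕ∞) : WithTop ℕ∞) ≤ ((⊤ : ℕ∞) : WithTop ℕ∞) :=
  WithTop.coe_le_coe.2 le_top

open SchwartzMap ContDiff in
theorem sgn_Kbdd {n : ℕ} {a : ℝ} (ha : a ≤ 0) {K : En n → ℝ} (hc : ContinuousOn K {(0 : En n)}ᶜ)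
    (hh : HomogeneousDeg n a K) : ∃ C, 0 ≤ C ∧ ∀ x, 1 ≤ ‖x‖ → |K x| ≤ C := by
  have hs : IsCompact (Metric.sphere (0 : En n) 1) := isCompact_sphere 0 1
  obtain ⟨C, hC⟩ := hs.exists_bound_of_continuousOn (f := K) (hc.mono (by
    intro x hx h
    simp only [Set.mem_singleton_iff] at h
    simp [h] at hx))
  refine ⟨max C 0, le_max_right _ _, fun x hx => ?_⟩
  have hx0 : x ≠ 0 := by rintro rfl; simp at hx; linarith
  have hn : ‖x‖ ≠ 0 := norm_ne_zero_iff.2 hx0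
  have h1 := hh ‖x‖ hn (‖x‖⁻¹ • x) (smul_ne_zero (inv_ne_zero hn) hx0)
  rw [smul_inv_smul₀ hn] at h1
  rw [h1, abs_mul, abs_norm, abs_of_nonneg (Real.rpow_nonneg (norm_nonneg _) _)]
  have h2 := hC (‖x‖⁻¹ • x) (by simp [norm_smul, inv_mul_cancel₀ hn])
  rw [Real.norm_eq_abs] at h2
  have h3 : ‖x‖ ^ a ≤ 1 := Real.rpow_le_one_of_one_le_of_nonpos hx ha
  calc _ ≤ 1 * |K (‖x‖⁻¹ • x)| := by gcongr
    _ ≤ _ := by rw [one_mul]; exact h2.trans (le_max_left _ _)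

theorem sgn_Kint {n : ℕ} {K : En n → ℝ} (hl : LocallyIntegrable K volume) {C : ℝ}
    (hC : ∀ x, 1 ≤ ‖x‖ → |K x| ≤ C) :
    Integrable (fun x => K x * (1 + ‖x‖) ^ (-(n + 1 : ℝ))) := by
  have hg : Integrable (fun x : En n => (1 + ‖x‖) ^ (-(n + 1 : ℝ))) :=
    integrable_one_add_norm (by simp)
  have hgc : Continuous (fun x : En n => (1 + ‖x‖) ^ (-(n + 1 : ℝ))) := by
    refine Continuous.rpow_const (by fun_prop) (fun x => Or.inl (by positivity))
  rw [← integrableOn_univ, ← Set.union_compl_self (Metric.closedBall (0 : En n) 1)]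
  refine IntegrableOn.union ?_ ?_
  · exact (hl.integrableOn_isCompact (isCompact_closedBall 0 1)).mul_continuousOn
      hgc.continuousOn (isCompact_closedBall 0 1)
  · refine Integrable.mono' ((hg.const_mul C).integrableOn)
      ((hl.aestronglyMeasurable.mul hgc.aestronglyMeasurable).restrict) ?_
    refine (ae_restrict_iff' (Metric.isClosed_closedBall.measurableSet.compl)).2 (ae_of_all _ ?_)
    intro x hx
    have : 1 ≤ ‖x‖ := by
      simp at hx; exact hx.le
    rw [norm_mul, Real.norm_eq_abs, Real.norm_eq_abs,
      abs_of_nonneg (Real.rpow_nonneg (by positivity : (0 : ℝ) ≤ 1 + ‖x‖) _)]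
    gcongr
    exact hC x this

theorem sgn_KFint {n : ℕ} {K F : En n → ℝ} (hl : LocallyIntegrable K volume)
    (hK : Integrable (fun x => K x * (1 + ‖x‖) ^ (-(n + 1 : ℝ)))) (hF : Continuous F) {D : ℝ}
    (hD : ∀ x, |F x| ≤ D * (1 + ‖x‖) ^ (-(n + 1 : ℝ))) : Integrable (fun x => K x * F x) := by
  refine Integrable.mono' ((hK.norm.const_mul D))
    (hl.aestronglyMeasurable.mul hF.aestronglyMeasurable) (ae_of_all _ fun x => ?_)
  rw [norm_mul, norm_mul, Real.norm_eq_abs, Real.norm_eq_abs, Real.norm_eq_abs,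
      abs_of_nonneg (Real.rpow_nonneg (by positivity : (0 : ℝ) ≤ 1 + ‖x‖) _)]
  calc _ ≤ |K x| * (D * (1 + ‖x‖) ^ (-(n + 1 : ℝ))) := by gcongr; exact hD x
    _ = _ := by ring

open SchwartzMap ContDiff in
theorem sgn_schw_decay {n : ℕ} (ψ : 𝓢(En n, ℝ)) (j : ℕ) : ∃ D, 0 ≤ D ∧ ∀ x,
    ‖iteratedFDeriv ℝ j ψ x‖ ≤ D * (1 + ‖x‖) ^ (-(n + 1 : ℝ)) := by
  refine ⟨2 ^ (n + 1) * ((Finset.Iic (n + 1, j)).sup fun m => SchwartzMap.seminorm ℝ m.1 m.2) ψ,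
    by positivity, fun x => ?_⟩
  have h := one_add_le_sup_seminorm_apply (𝕜 := ℝ) (m := (n + 1, j)) (k := n + 1) (n := j)
    le_rfl le_rfl ψ x
  have e : (1 + ‖x‖) ^ (n + 1 : ℝ) = (1 + ‖x‖) ^ (n + 1) := by
    exact_mod_cast Real.rpow_natCast (1 + ‖x‖) (n + 1)
  rw [Real.rpow_neg (by positivity), ← div_eq_mul_inv, le_div_iff₀ (by positivity), mul_comm, e]
  exact h

theorem sgn_opL_le {n m : ℕ} (A : (Fin (2*m) → Fin n) → ℝ) (f : En n → ℝ) (x : En n) :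
    |opL n m A f x| ≤ (∑ i, |A i|) * ‖iteratedFDeriv ℝ (2*m) f x‖ := by
  unfold opL
  rw [abs_mul, abs_pow, abs_neg, abs_one, one_pow, one_mul, Finset.sum_mul]
  refine (Finset.abs_sum_le_sum_abs _ _).trans (Finset.sum_le_sum fun i _ => ?_)
  rw [abs_mul]
  gcongr
  have := (iteratedFDeriv ℝ (2*m) f x).le_opNorm (fun j => stdB n (i j))
  simpa [stdB] using this

open SchwartzMap ContDiff in
theorem sgn_fund_schwartz {n m : ℕ} {A : (Fin (2*m) → Fin n) → ℝ} {K : En n → ℝ}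
    (hl : LocallyIntegrable K volume)
    (hK : Integrable (fun x => K x * (1 + ‖x‖) ^ (-(n + 1 : ℝ))))
    (hf : IsFundamentalSolution n m A K) (ψ : 𝓢(En n, ℝ)) :
    ∫ y, K y * opL n m A ψ y = ψ 0 := by
  let χ : ContDiffBump (0 : En n) := ⟨1, 2, one_pos, one_lt_two⟩
  have hχs : ContDiff ℝ ∞ χ := χ.contDiff
  let χS : 𝓢(En n, ℝ) := χ.hasCompactSupport.toSchwartzMap hχs
  let g : ℕ → (En n →L[ℝ] En n) := fun k => ((k + 1 : ℝ)⁻¹) • ContinuousLinearMap.id ℝ (En n)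
  have hg : ∀ k x, g k x = (k + 1 : ℝ)⁻¹ • x := fun k x => rfl
  have hgn : ∀ k, ‖g k‖ ≤ 1 := by
    intro k
    refine ContinuousLinearMap.opNorm_le_bound _ zero_le_one fun x => ?_
    rw [hg, norm_smul, one_mul]
    have : ‖(k + 1 : ℝ)⁻¹‖ ≤ 1 := by
      rw [norm_inv]
      apply inv_le_one_of_one_le₀
      rw [Real.norm_of_nonneg (by positivity)]
      linarith [(Nat.cast_nonneg k : (0 : ℝ) ≤ k)]
    calc _ ≤ 1 * ‖x‖ := by gcongr
      _ = _ := one_mul _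
  let χk : ℕ → En n → ℝ := fun k => χ ∘ g k
  have hχk : ∀ k, ContDiff ℝ ∞ (χk k) := fun k => hχs.comp (g k).contDiff
  have hχd : ∀ k i x, ‖iteratedFDeriv ℝ i (χk k) x‖ ≤ SchwartzMap.seminorm ℝ 0 i χS := by
    intro k i x
    have h1 := (g k).iteratedFDeriv_comp_right hχs x (i := i) (by exact_mod_cast le_top)
    simp only [χk]
    rw [h1]
    refine (ContinuousMultilinearMap.norm_compContinuousLinearMap_le _ _).trans ?_
    have h2 : ‖iteratedFDeriv ℝ i χ (g k x)‖ ≤ SchwartzMap.seminorm ℝ 0 i χS :=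
      norm_iteratedFDeriv_le_seminorm ℝ χS i _
    have h3 : ∏ _j : Fin i, ‖g k‖ ≤ 1 := Finset.prod_le_one (fun _ _ => norm_nonneg _) (fun _ _ => hgn k)
    calc _ ≤ SchwartzMap.seminorm ℝ 0 i χS * 1 := by gcongr
      _ = _ := mul_one _
  choose D hD0 hD using sgn_schw_decay ψ
  let C : ℝ := (∑ i, |A i|) * ∑ i ∈ Finset.range (2 * m + 1), ((2 * m).choose i : ℝ) *
    SchwartzMap.seminorm ℝ 0 i χS * D (2 * m - i)
  have hbound : ∀ k x, |opL n m A (fun y => χk k y * ψ y) x| ≤ C * (1 + ‖x‖) ^ (-(n + 1 : ℝ)) := by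
    intro k x
    refine (sgn_opL_le A _ x).trans ?_
    simp only [C]
    rw [mul_assoc (∑ i, |A i|)]
    have hA0 : 0 ≤ ∑ i, |A i| := Finset.sum_nonneg fun _ _ => abs_nonneg _
    refine mul_le_mul_of_nonneg_left ?_ hA0
    rw [Finset.sum_mul]
    refine (norm_iteratedFDeriv_mul_le (hχk k) (ψ.smooth ⊤) x (n := 2 * m)
      (sgn_le_inf _)).trans ?_
    refine Finset.sum_le_sum fun i _ => ?_
    have h1 := hD (2 * m - i) x
    have h2 := hχd k i x
    have h3 := hD0 (2 * m - i)
    calc _ ≤ ((2 * m).choose i : ℝ) * SchwartzMap.seminorm ℝ 0 i χS *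
          (D (2 * m - i) * (1 + ‖x‖) ^ (-(n + 1 : ℝ))) := by gcongr
      _ = _ := by ring
  have hlim : Filter.Tendsto (fun k : ℕ => ∫ y, K y * opL n m A (fun y => χk k y * ψ y) y)
      Filter.atTop (nhds (∫ y, K y * opL n m A ψ y)) := by
    refine tendsto_integral_of_dominated_convergence
      (fun x => C * ‖K x * (1 + ‖x‖) ^ (-(n + 1 : ℝ))‖) ?_ (hK.norm.const_mul C) ?_ ?_
    · intro k
      refine hl.aestronglyMeasurable.mul (Continuous.aestronglyMeasurable ?_)
      unfold opL
      refine continuous_const.mul (continuous_finsetSum _ fun i _ => continuous_const.mul ?_)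
      have : ContDiff ℝ ∞ (fun y => χk k y * ψ y) := (hχk k).mul (ψ.smooth ⊤)
      have h2 := this.continuous_iteratedFDeriv (m := 2 * m) (sgn_le_inf _)
      exact h2.eval_const _
    · intro k
      refine ae_of_all _ fun x => ?_
      rw [norm_mul, norm_mul, Real.norm_eq_abs, Real.norm_eq_abs, Real.norm_eq_abs,
        abs_of_nonneg (Real.rpow_nonneg (by positivity : (0 : ℝ) ≤ 1 + ‖x‖) _)]
      calc _ ≤ |K x| * (C * (1 + ‖x‖) ^ (-(n + 1 : ℝ))) := by gcongr; exact hbound k x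
        _ = _ := by ring
    · refine ae_of_all _ fun x => ?_
      refine tendsto_const_nhds.congr' ?_
      obtain ⟨k0, hk0⟩ := exists_nat_gt ‖x‖
      filter_upwards [Filter.eventually_ge_atTop k0] with k hk
      congr 1
      have hev : (fun y => χk k y * ψ y) =ᶠ[nhds x] ψ := by
        have : ∀ᶠ y in nhds x, ‖y‖ < k + 1 := by
          refine (continuous_norm.tendsto x).eventually_lt_const ?_
          have : (k0 : ℝ) ≤ k := by exact_mod_cast hk
          linarith
        filter_upwards [this] with y hy
        have : χk k y = 1 := by
          apply χ.one_of_mem_closedBall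
          rw [mem_closedBall_zero_iff, hg, norm_smul, norm_inv, Real.norm_of_nonneg (by positivity)]
          rw [inv_mul_le_iff₀ (by positivity)]
          change ‖y‖ ≤ (k + 1 : ℝ) * 1
          linarith
        rw [this, one_mul]
      unfold opL
      rw [Filter.EventuallyEq.eq_of_nhds (hev.iteratedFDeriv ℝ (2 * m))]
  have hval : ∀ k, ∫ y, K y * opL n m A (fun y => χk k y * ψ y) y = ψ 0 := by
    intro k
    rw [hf (fun y => χk k y * ψ y) ((hχk k).mul (ψ.smooth ⊤)) ?_]
    · have : χk k 0 = 1 := by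
        simp only [χk, Function.comp, map_zero]
        exact χ.one_of_mem_closedBall (by simp [χ])
      rw [this, one_mul]
    · refine HasCompactSupport.mul_right ?_
      have h0 : (k + 1 : ℝ)⁻¹ ≠ 0 := by positivity
      have h1 : HasCompactSupport (fun x : En n => χ ((k + 1 : ℝ)⁻¹ • x)) :=
        HasCompactSupport.comp_smul (f := fun x : En n => χ x) χ.hasCompactSupport h0
      exact h1
  simp only [hval] at hlim
  exact tendsto_nhds_unique hlim tendsto_const_nhds


open SchwartzMap ContDiff FourierTransform in
theorem sgn_opL_fourier {n m : ℕ} (A : (Fin (2*m) → Fin n) → ℝ) {h : En n → ℝ}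
    (hs : ContDiff ℝ ∞ h) (hc : HasCompactSupport h) (M : En n →L[ℝ] En n)
    (hM : ∀ x y, ⟪M x, y⟫ = ⟪x, M y⟫) (x : En n) :
    opL n m A (fun x => (𝓕 (fun ζ => (h ζ : ℂ)) (M x)).re) x =
      (2 * Real.pi) ^ (2 * m) *
        (𝓕 (fun ζ => ((symbolQ n m A (M ζ) * h ζ : ℝ) : ℂ)) (M x)).re := by
  have hcC : HasCompactSupport (fun ζ => (h ζ : ℂ)) := hc.comp_left Complex.ofReal_zero
  have hsC : ContDiff ℝ ∞ (fun ζ => (h ζ : ℂ)) := Complex.ofRealCLM.contDiff.comp hs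
  set hC : 𝓢(En n, ℂ) := hcC.toSchwartzMap hsC with hhC
  have hcoe : (hC : En n → ℂ) = fun ζ => (h ζ : ℂ) := rfl
  have hF : ContDiff ℝ ∞ (𝓕 (fun ζ => (h ζ : ℂ))) := by
    have := (𝓕 hC).smooth ⊤
    rwa [fourier_coe, hcoe] at this
  have hint : ∀ k : ℕ, (k : ℕ∞) ≤ ⊤ → Integrable (fun v => ‖v‖ ^ k * ‖(h v : ℂ)‖) :=
    fun k _ => hC.integrable_pow_mul volume k
  have hmeas : AEStronglyMeasurable (fun ζ => (h ζ : ℂ)) volume := hsC.continuous.aestronglyMeasurable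
  have key : ∀ i : Fin (2*m) → Fin n,
      iteratedFDeriv ℝ (2*m) (fun x => (𝓕 (fun ζ => (h ζ : ℂ)) (M x)).re) x
        (fun j => stdB n (i j)) =
      (-1) ^ m * ((2 * Real.pi) ^ (2 * m) *
        (𝓕 (fun ζ => (((∏ j, (M ζ) (i j)) * h ζ : ℝ) : ℂ)) (M x)).re) := by
    intro i
    have e1 := Complex.reCLM.iteratedFDeriv_comp_left
      (f := (𝓕 (fun ζ => (h ζ : ℂ))) ∘ M) (x := x) (i := 2 * m) (n := ∞)
      (hF.comp M.contDiff).contDiffAt (sgn_le_inf _)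
    have e2 := M.iteratedFDeriv_comp_right hF x (i := 2 * m) (sgn_le_inf _)
    have e0 : (fun x => (𝓕 (fun ζ => (h ζ : ℂ)) (M x)).re) =
      Complex.reCLM ∘ ((𝓕 (fun ζ => (h ζ : ℂ))) ∘ M) := rfl
    rw [e0, e1, e2, Real.iteratedFDeriv_fourier (N := ⊤) hint hmeas le_top]
    simp only [ContinuousLinearMap.compContinuousMultilinearMap_coe, Function.comp_apply,
      ContinuousMultilinearMap.compContinuousLinearMap_apply]
    rw [Real.fourier_continuousMultilinearMap_apply
      (VectorFourier.integrable_fourierPowSMulRight (innerSL ℝ) (hint _ le_top) hmeas)]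
    have e3 : (fun ζ => VectorFourier.fourierPowSMulRight (innerSL ℝ) (fun ζ => (h ζ : ℂ)) ζ (2 * m)
        (fun j => M (stdB n (i j)))) = fun ζ => (((-1) ^ m * (2 * Real.pi) ^ (2 * m) : ℝ) : ℂ) •
          (((∏ j, (M ζ) (i j)) * h ζ : ℝ) : ℂ) := by
      funext ζ
      rw [VectorFourier.fourierPowSMulRight_apply]
      have e4 : ∀ j, (innerSL ℝ ζ) (M (stdB n (i j))) = (M ζ) (i j) := by
        intro j
        rw [innerSL_apply_apply, ← hM]
        simp [stdB, EuclideanSpace.inner_single_right]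
      have e5 : (-(2 * (Real.pi : ℂ) * Complex.I)) ^ (2 * m)
          = (((-1) ^ m * (2 * Real.pi) ^ (2 * m) : ℝ) : ℂ) := by
        rw [neg_pow, mul_pow, pow_mul Complex.I, Complex.I_sq]
        push_cast
        rw [pow_mul (-1 : ℂ)]
        ring
      simp only [e4]
      rw [e5]
      simp
    rw [e3]
    have e6 : 𝓕 (fun ζ => (((-1) ^ m * (2 * Real.pi) ^ (2 * m) : ℝ) : ℂ) •
          (((∏ j, (M ζ) (i j)) * h ζ : ℝ) : ℂ)) (M x) =
        (((-1) ^ m * (2 * Real.pi) ^ (2 * m) : ℝ) : ℂ) •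
          𝓕 (fun ζ => (((∏ j, (M ζ) (i j)) * h ζ : ℝ) : ℂ)) (M x) := by
      rw [Real.fourier_eq, Real.fourier_eq, ← integral_smul]
      congr 1
      funext v
      rw [smul_comm]
    rw [e6, smul_eq_mul, Complex.reCLM_apply, Complex.re_ofReal_mul]
    ring
  have hsum : 𝓕 (fun ζ => ((symbolQ n m A (M ζ) * h ζ : ℝ) : ℂ)) (M x) =
      ∑ i, (A i : ℂ) * 𝓕 (fun ζ => (((∏ j, (M ζ) (i j)) * h ζ : ℝ) : ℂ)) (M x) := by
    simp only [Real.fourier_eq]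
    simp_rw [← integral_const_mul]
    rw [← integral_finsetSum]
    · congr 1
      funext v
      simp only [symbolQ, Finset.sum_mul, Complex.ofReal_sum, Finset.smul_sum]
      refine Finset.sum_congr rfl fun i _ => ?_
      push_cast
      simp only [Circle.smul_def, smul_eq_mul]
      ring
    · intro i _
      have hco : ∀ j, Continuous fun ζ : En n => (M ζ) (i j) := fun j =>
        (EuclideanSpace.proj (i j) : En n →L[ℝ] ℝ).continuous.comp M.continuous
      refine Integrable.const_mul ?_ _
      refine (Real.fourierIntegral_convergent_iff (M x)).2 ?_
      have h1 : Continuous (fun ζ : En n => (∏ j, (M ζ) (i j)) * h ζ) :=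
        (continuous_finsetProd _ fun j _ => hco j).mul hs.continuous
      have h2 : HasCompactSupport (fun ζ : En n => (∏ j, (M ζ) (i j)) * h ζ) :=
        HasCompactSupport.mul_left (f := fun ζ : En n => ∏ j, (M ζ) (i j)) hc
      have h3 := (h1.integrable_of_hasCompactSupport (μ := volume) h2).ofReal (𝕜 := ℂ)
      exact h3
  unfold opL
  simp only [key]
  rw [hsum, Complex.re_sum]
  simp only [Complex.re_ofReal_mul]
  rw [Finset.mul_sum, Finset.mul_sum]
  refine Finset.sum_congr rfl fun i _ => ?_
  have : ((-1 : ℝ)) ^ m * (-1) ^ m = 1 := by rw [← mul_pow]; simp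
  linear_combination (A i * ((2 * Real.pi) ^ (2 * m) *
        (𝓕 (fun ζ => (((∏ j, (M ζ) (i j)) * h ζ : ℝ) : ℂ)) (M x)).re)) * this


open SchwartzMap ContDiff FourierTransform in
theorem sgn_schw_exists {n : ℕ} {h : En n → ℝ}
    (hs : ContDiff ℝ ∞ h) (hc : HasCompactSupport h) (M : En n ≃L[ℝ] En n) :
    ∃ ψ : 𝓢(En n, ℝ), ∀ x, ψ x = (𝓕 (fun ζ => (h ζ : ℂ)) (M x)).re := by
  have hcC : HasCompactSupport (fun ζ => (h ζ : ℂ)) := hc.comp_left Complex.ofReal_zero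
  have hsC : ContDiff ℝ ∞ (fun ζ => (h ζ : ℂ)) := Complex.ofRealCLM.contDiff.comp hs
  refine ⟨(compCLMOfContinuousLinearEquiv ℝ M
    (𝓕 (hcC.toSchwartzMap hsC))).postcompCLM Complex.reCLM, fun x => ?_⟩
  rw [postcompCLM_apply, compCLMOfContinuousLinearEquiv_apply, fourier_coe]
  rfl

open SchwartzMap ContDiff FourierTransform in
theorem sgn_symbolQ_smooth {n m : ℕ} (A : (Fin (2*m) → Fin n) → ℝ) :
    ContDiff ℝ ∞ (symbolQ n m A) := by
  unfold symbolQ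
  refine ContDiff.sum fun i _ => contDiff_const.mul (contDiff_prod fun j _ => ?_)
  exact (EuclideanSpace.proj (i j) : En n →L[ℝ] ℝ).contDiff

open SchwartzMap ContDiff FourierTransform in
theorem sgn_identity {n m : ℕ} {A : (Fin (2*m) → Fin n) → ℝ} {K : En n → ℝ}
    (hQ : ∀ ξ : En n, ξ ≠ 0 → 0 < symbolQ n m A ξ)
    (hl : LocallyIntegrable K volume)
    (hK : Integrable (fun x => K x * (1 + ‖x‖) ^ (-(n + 1 : ℝ))))
    (hf : IsFundamentalSolution n m A K) (M : En n ≃L[ℝ] En n)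
    (hM : ∀ x y, ⟪M x, y⟫ = ⟪x, M y⟫) {g : En n → ℝ}
    (hs : ContDiff ℝ ∞ g) (hc : HasCompactSupport g) (h0 : (0 : En n) ∉ tsupport g) :
    Integrable (fun x => K x * (𝓕 (fun ζ => (g ζ : ℂ)) (M x)).re) ∧
    (2 * Real.pi) ^ (2 * m) * ∫ x, K x * (𝓕 (fun ζ => (g ζ : ℂ)) (M x)).re =
      ∫ ζ, g ζ / symbolQ n m A (M ζ) := by
  constructor
  · obtain ⟨φ, hφ⟩ := sgn_schw_exists hs hc M
    obtain ⟨D, -, hD⟩ := sgn_schw_decay φ 0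
    have := sgn_KFint hl hK φ.continuous (D := D) (fun x => by simpa using hD x)
    simpa only [hφ] using this
  set h : En n → ℝ := fun ζ => g ζ / symbolQ n m A (M ζ) with hh
  have hQM : ∀ ζ : En n, ζ ≠ 0 → symbolQ n m A (M ζ) ≠ 0 := fun ζ hζ =>
    (hQ _ (by simpa using hζ)).ne'
  have hsup : tsupport h ⊆ tsupport g := by
    refine closure_mono fun x hx => ?_
    simp only [Function.mem_support, hh] at hx ⊢
    intro h
    simp [h] at hx
  have hch : HasCompactSupport h := hc.of_isClosed_subset (isClosed_tsupport _) hsup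
  have hsh : ContDiff ℝ ∞ h := by
    rw [contDiff_iff_contDiffAt]
    intro x
    by_cases hx : x ∈ tsupport h
    swap
    · exact (contDiffAt_const (c := (0 : ℝ))).congr_of_eventuallyEq
        (notMem_tsupport_iff_eventuallyEq.1 hx)
    refine hs.contDiffAt.div ((sgn_symbolQ_smooth A).comp M.contDiff).contDiffAt ?_
    refine hQM x ?_
    rintro rfl
    exact h0 (hsup hx)
  obtain ⟨ψ, hψ⟩ := sgn_schw_exists hsh hch M
  have hψ' : (ψ : En n → ℝ) = fun x => (𝓕 (fun ζ => (h ζ : ℂ)) (M x)).re := funext hψ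
  have key := sgn_fund_schwartz hl hK hf ψ
  rw [hψ] at key
  have e1 : ∀ x, opL n m A ψ x =
      (2 * Real.pi) ^ (2 * m) * (𝓕 (fun ζ => (g ζ : ℂ)) (M x)).re := by
    intro x
    rw [hψ']
    have := sgn_opL_fourier A hsh hch (M : En n →L[ℝ] En n) hM x
    simp only [ContinuousLinearEquiv.coe_coe] at this
    rw [this]
    have e : (fun ζ => ((symbolQ n m A (M ζ) * h ζ : ℝ) : ℂ)) = fun ζ => (g ζ : ℂ) := by
      funext ζ
      by_cases hζ : ζ = 0
      · have : g ζ = 0 := by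
          rw [hζ]
          exact image_eq_zero_of_notMem_tsupport h0
        simp [hh, this]
      · simp only [hh]
        rw [mul_div_cancel₀ _ (hQM ζ hζ)]
    rw [e]
  simp only [e1] at key
  rw [← integral_const_mul]
  calc _ = _ := by congr 1; funext x; ring
    _ = _ := key
    _ = _ := by
      rw [map_zero, Real.fourier_eq]
      simp only [inner_zero_right, neg_zero, AddChar.map_zero_eq_one, one_smul]
      have : ∫ v, (h v : ℂ) = ((∫ v, h v : ℝ) : ℂ) := integral_ofReal
      rw [this, Complex.ofReal_re]



theorem sgn_D0 {n : ℕ} (η : ℝ → ℝ) (y : En n) {s : ℝ} (hs : 0 < s) :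
    ∫ ξ : En n, η (‖ξ‖ ^ 2 / s ^ 2) * Real.cos (2 * Real.pi * ⟪ξ, y⟫) =
      s ^ n * ∫ ξ : En n, η (‖ξ‖ ^ 2) * Real.cos (2 * Real.pi * ⟪ξ, s • y⟫) := by
  have := Measure.integral_comp_inv_smul (volume : Measure (En n))
    (fun ξ : En n => η (‖ξ‖ ^ 2) * Real.cos (2 * Real.pi * ⟪ξ, s • y⟫)) s
  rw [finrank_euclideanSpace_fin, abs_of_pos (by positivity), smul_eq_mul] at this
  rw [← this]
  congr 1
  funext ξ
  rw [norm_smul, inner_smul_left, inner_smul_right, norm_inv, Real.norm_of_nonneg hs.le]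
  simp only [conj_trivial]
  rw [inv_mul_cancel_left₀ hs.ne', mul_pow, inv_pow, div_eq_inv_mul]

theorem sgn_D1 (η : ℝ → ℝ) {r : ℝ} (hr : 0 < r) :
    ∫ s in Set.Ioi (0 : ℝ), s⁻¹ * Real.exp (-Real.pi * s ^ 2) * η (r ^ 2 / s ^ 2) =
      ∫ u in Set.Ioi (0 : ℝ), u⁻¹ * Real.exp (-Real.pi * (r ^ 2 / u ^ 2)) * η (u ^ 2) := by
  have h1 := integral_comp_rpow_Ioi
    (fun u : ℝ => u⁻¹ * Real.exp (-Real.pi * (r ^ 2 / u ^ 2)) * η (u ^ 2)) (p := -1) (by norm_num)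
  have h2 := integral_comp_mul_left_Ioi'
    (fun s : ℝ => s⁻¹ * Real.exp (-Real.pi * s ^ 2) * η (r ^ 2 / s ^ 2)) 0 hr
  rw [mul_zero] at h2
  rw [← h1, ← h2, smul_eq_mul, ← integral_const_mul]
  refine setIntegral_congr_fun measurableSet_Ioi fun x hx => ?_
  have hx : 0 < x := hx
  have e1 : x ^ (-1 - 1 : ℝ) = (x ^ 2)⁻¹ := by
    rw [show (-1 - 1 : ℝ) = -(2 : ℕ) by norm_num, Real.rpow_neg hx.le, Real.rpow_natCast]
  simp only [Real.rpow_neg_one, e1, abs_neg, abs_one, one_mul, smul_eq_mul]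
  have e2 : r ^ 2 / (r * x) ^ 2 = x⁻¹ ^ 2 := by field_simp
  have e3 : r ^ 2 / x⁻¹ ^ 2 = (r * x) ^ 2 := by field_simp
  rw [e2, e3]
  field_simp

theorem sgn_D2 {n : ℕ} (y : En n) :
    ∫ ξ : En n, Real.exp (-Real.pi * ‖ξ‖ ^ 2) * Real.cos (2 * Real.pi * ⟪ξ, y⟫) =
      Real.exp (-Real.pi * ‖y‖ ^ 2) := by
  have hb : 0 < (Real.pi : ℂ).re := by simpa using Real.pi_pos
  have h1 := GaussianFourier.integral_cexp_neg_mul_sq_norm_add hb (2 * Real.pi * Complex.I) y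
  have h2 := GaussianFourier.integrable_cexp_neg_mul_sq_norm_add hb (2 * Real.pi * Complex.I) y
  have hpi : (Real.pi : ℂ) ≠ 0 := by exact_mod_cast Real.pi_ne_zero
  rw [div_self hpi, Complex.one_cpow, one_mul] at h1
  have h3 := congrArg Complex.re h1
  rw [← Complex.reCLM_apply, ← Complex.reCLM.integral_comp_comm h2] at h3
  have e1 : (2 * Real.pi * Complex.I) ^ 2 * (‖y‖ : ℂ) ^ 2 / (4 * Real.pi) =
      ((-Real.pi * ‖y‖ ^ 2 : ℝ) : ℂ) := by
    rw [mul_pow, Complex.I_sq]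
    push_cast
    field_simp
    ring
  rw [e1, Complex.exp_ofReal_re] at h3
  rw [← h3]
  congr 1
  funext ξ
  rw [Complex.reCLM_apply, Complex.exp_re]
  congr 1
  · congr 1
    simp [← Complex.ofReal_pow]
  · congr 1
    rw [real_inner_comm]
    simp [← Complex.ofReal_pow]

theorem sgn_D3 {n : ℕ} (y : En n) {u : ℝ} (hu : 0 < u) :
    ∫ ξ : En n, Real.exp (-Real.pi * (‖ξ‖ ^ 2 / u ^ 2)) * Real.cos (2 * Real.pi * ⟪ξ, y⟫) =
      u ^ n * Real.exp (-Real.pi * (u ^ 2 * ‖y‖ ^ 2)) := by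
  rw [sgn_D0 (fun t => Real.exp (-Real.pi * t)) y hu, sgn_D2, norm_smul, Real.norm_of_nonneg hu.le,
    mul_pow]

theorem sgn_D3int {n : ℕ} {u : ℝ} (hu : 0 < u) :
    Integrable (fun ξ : En n => Real.exp (-Real.pi * (‖ξ‖ ^ 2 / u ^ 2))) := by
  by_contra h
  have h1 := sgn_D3 (0 : En n) hu
  simp only [inner_zero_right, mul_zero, Real.cos_zero, mul_one] at h1
  rw [integral_undef h] at h1
  have : 0 < u ^ n * Real.exp (-Real.pi * (u ^ 2 * ‖(0 : En n)‖ ^ 2)) := by positivity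
  simp only [norm_zero] at h1 this
  norm_num at h1 this
  linarith

/-- measurability and integrability for the first Fubini -/
theorem sgn_D4 {n : ℕ} {η : ℝ → ℝ} (hη : Continuous η) (h0 : ∀ t, 0 ≤ η t)
    (h3 : ∀ t, 3 ≤ t → η t = 0) (hn : 1 ≤ n) (y : En n) :
    Integrable (fun p : ℝ × En n => p.1⁻¹ * Real.exp (-Real.pi * p.1 ^ 2) *
      η (‖p.2‖ ^ 2 / p.1 ^ 2) * Real.cos (2 * Real.pi * ⟪p.2, y⟫))
      ((volume.restrict (Set.Ioi (0 : ℝ))).prod volume) := by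
  have hm : Measurable (fun p : ℝ × En n => p.1⁻¹ * Real.exp (-Real.pi * p.1 ^ 2) *
      η (‖p.2‖ ^ 2 / p.1 ^ 2) * Real.cos (2 * Real.pi * ⟪p.2, y⟫)) := by
    have := hη.measurable
    fun_prop
  have hm2 : Measurable (fun p : ℝ × En n => p.1⁻¹ * Real.exp (-Real.pi * p.1 ^ 2) *
      η (‖p.2‖ ^ 2 / p.1 ^ 2)) := by
    have := hη.measurable
    fun_prop
  suffices H : Integrable (fun p : ℝ × En n => p.1⁻¹ * Real.exp (-Real.pi * p.1 ^ 2) *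
      η (‖p.2‖ ^ 2 / p.1 ^ 2)) ((volume.restrict (Set.Ioi (0 : ℝ))).prod volume) by
    refine H.mono hm.aestronglyMeasurable (ae_of_all _ fun p => ?_)
    rw [norm_mul _ (Real.cos _)]
    exact mul_le_of_le_one_right (norm_nonneg _) (Real.abs_cos_le_one _)
  rw [integrable_prod_iff hm2.aestronglyMeasurable]
  constructor
  · filter_upwards [ae_restrict_mem measurableSet_Ioi] with s hs
    have hs : 0 < s := hs
    refine Integrable.const_mul ?_ _
    refine Continuous.integrable_of_hasCompactSupport (by fun_prop) ?_
    refine HasCompactSupport.intro (isCompact_closedBall (0 : En n) (2 * s)) fun x hx => h3 _ ?_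
    have hx : 2 * s < ‖x‖ := by simpa using hx
    rw [le_div_iff₀ (by positivity)]
    nlinarith
  · have e : ∀ s ∈ Set.Ioi (0 : ℝ), (∫ ξ : En n, ‖s⁻¹ * Real.exp (-Real.pi * s ^ 2) *
        η (‖ξ‖ ^ 2 / s ^ 2)‖) =
        s ^ ((n - 1 : ℕ) : ℝ) * Real.exp (-Real.pi * s ^ 2) * ∫ ξ : En n, η (‖ξ‖ ^ 2) := by
      intro s hs
      have hs : 0 < s := hs
      have h1 := sgn_D0 η (0 : En n) hs
      simp only [inner_zero_right, mul_zero, Real.cos_zero, mul_one, smul_zero] at h1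
      have h2 : ∀ ξ : En n, ‖s⁻¹ * Real.exp (-Real.pi * s ^ 2) * η (‖ξ‖ ^ 2 / s ^ 2)‖ =
        s⁻¹ * Real.exp (-Real.pi * s ^ 2) * η (‖ξ‖ ^ 2 / s ^ 2) := fun ξ =>
        Real.norm_of_nonneg (mul_nonneg (by positivity) (h0 _))
      simp only [h2]
      rw [integral_const_mul, h1, Real.rpow_natCast]
      obtain ⟨k, rfl⟩ : ∃ k, n = k + 1 := ⟨n - 1, by omega⟩
      rw [Nat.add_sub_cancel]
      field_simp
      ring
    refine IntegrableOn.congr_fun (f := fun s : ℝ => s ^ ((n - 1 : ℕ) : ℝ) *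
      Real.exp (-Real.pi * s ^ 2) * ∫ ξ : En n, η (‖ξ‖ ^ 2)) ?_ (fun s hs => (e s hs).symm)
      measurableSet_Ioi
    refine Integrable.mul_const ?_ _
    refine (integrable_rpow_mul_exp_neg_mul_sq Real.pi_pos ?_).integrableOn
    have : (0 : ℝ) ≤ ((n - 1 : ℕ) : ℝ) := Nat.cast_nonneg _
    linarith

theorem sgn_D5 {n : ℕ} {η : ℝ → ℝ} (hη : Continuous η) (h0 : ∀ t, 0 ≤ η t)
    (h3 : ∀ t, 3 ≤ t → η t = 0) (hn : 1 ≤ n) (y : En n) :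
    Integrable (fun p : ℝ × En n => p.1⁻¹ * Real.exp (-Real.pi * (‖p.2‖ ^ 2 / p.1 ^ 2)) *
      η (p.1 ^ 2) * Real.cos (2 * Real.pi * ⟪p.2, y⟫))
      ((volume.restrict (Set.Ioi (0 : ℝ))).prod volume) := by
  have hm : Measurable (fun p : ℝ × En n => p.1⁻¹ * Real.exp (-Real.pi * (‖p.2‖ ^ 2 / p.1 ^ 2)) *
      η (p.1 ^ 2) * Real.cos (2 * Real.pi * ⟪p.2, y⟫)) := by
    have := hη.measurable
    fun_prop
  have hm2 : Measurable (fun p : ℝ × En n => p.1⁻¹ * Real.exp (-Real.pi * (‖p.2‖ ^ 2 / p.1 ^ 2)) *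
      η (p.1 ^ 2)) := by
    have := hη.measurable
    fun_prop
  suffices H : Integrable (fun p : ℝ × En n => p.1⁻¹ *
      Real.exp (-Real.pi * (‖p.2‖ ^ 2 / p.1 ^ 2)) * η (p.1 ^ 2))
      ((volume.restrict (Set.Ioi (0 : ℝ))).prod volume) by
    refine H.mono hm.aestronglyMeasurable (ae_of_all _ fun p => ?_)
    rw [norm_mul _ (Real.cos _)]
    exact mul_le_of_le_one_right (norm_nonneg _) (Real.abs_cos_le_one _)
  rw [integrable_prod_iff hm2.aestronglyMeasurable]
  constructor
  · filter_upwards [ae_restrict_mem measurableSet_Ioi] with s hs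
    exact ((sgn_D3int hs).const_mul _).mul_const _
  · have e : ∀ s ∈ Set.Ioi (0 : ℝ), (∫ ξ : En n, ‖s⁻¹ *
        Real.exp (-Real.pi * (‖ξ‖ ^ 2 / s ^ 2)) * η (s ^ 2)‖) = s ^ (n - 1) * η (s ^ 2) := by
      intro s hs
      have hs : 0 < s := hs
      have h1 := sgn_D3 (0 : En n) hs
      simp only [inner_zero_right, mul_zero, Real.cos_zero, mul_one, norm_zero] at h1
      have h2 : ∀ ξ : En n, ‖s⁻¹ * Real.exp (-Real.pi * (‖ξ‖ ^ 2 / s ^ 2)) * η (s ^ 2)‖ =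
        s⁻¹ * Real.exp (-Real.pi * (‖ξ‖ ^ 2 / s ^ 2)) * η (s ^ 2) := fun ξ =>
        Real.norm_of_nonneg (mul_nonneg (by positivity) (h0 _))
      simp only [h2]
      rw [integral_mul_const, integral_const_mul, h1]
      obtain ⟨k, rfl⟩ : ∃ k, n = k + 1 := ⟨n - 1, by omega⟩
      rw [Nat.add_sub_cancel, pow_succ]
      norm_num
      field_simp
      simp
    refine IntegrableOn.congr_fun (f := fun s : ℝ => s ^ (n - 1) * η (s ^ 2)) ?_
      (fun s hs => (e s hs).symm) measurableSet_Ioi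
    refine Integrable.integrableOn ?_
    refine Continuous.integrable_of_hasCompactSupport (by fun_prop) ?_
    refine HasCompactSupport.intro (isCompact_closedBall (0 : ℝ) 2) fun x hx => ?_
    have hx : 2 < |x| := by simpa using hx
    rw [h3, mul_zero]
    rw [← sq_abs]
    nlinarith

theorem sgn_L5 {n : ℕ} {η : ℝ → ℝ} (hη : Continuous η) (h0 : ∀ t, 0 ≤ η t)
    (h3 : ∀ t, 3 ≤ t → η t = 0) (hn : 1 ≤ n) (y : En n) :
    ∫ s in Set.Ioi (0 : ℝ), s ^ (n - 1) * Real.exp (-Real.pi * s ^ 2) *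
      ∫ ξ : En n, η (‖ξ‖ ^ 2) * Real.cos (2 * Real.pi * ⟪ξ, s • y⟫) =
    ∫ u in Set.Ioi (0 : ℝ), u ^ (n - 1) * η (u ^ 2) *
      Real.exp (-Real.pi * (u ^ 2 * ‖y‖ ^ 2)) := by
  have : Nonempty (Fin n) := ⟨⟨0, hn⟩⟩
  have hpw : ∀ s : ℝ, 0 < s → s ^ (n - 1) = s⁻¹ * s ^ n := by
    intro s hs
    obtain ⟨k, rfl⟩ : ∃ k, n = k + 1 := ⟨n - 1, by omega⟩
    rw [Nat.add_sub_cancel, pow_succ]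
    field_simp
  calc _ = ∫ s in Set.Ioi (0 : ℝ), ∫ ξ : En n, s⁻¹ * Real.exp (-Real.pi * s ^ 2) *
      η (‖ξ‖ ^ 2 / s ^ 2) * Real.cos (2 * Real.pi * ⟪ξ, y⟫) := by
        refine setIntegral_congr_fun measurableSet_Ioi fun s hs => ?_
        have hs : 0 < s := hs
        simp only [mul_assoc (s⁻¹ * Real.exp (-Real.pi * s ^ 2))]
        rw [integral_const_mul, sgn_D0 η y hs, hpw s hs]
        ring
    _ = ∫ ξ : En n, ∫ s in Set.Ioi (0 : ℝ), s⁻¹ * Real.exp (-Real.pi * s ^ 2) *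
      η (‖ξ‖ ^ 2 / s ^ 2) * Real.cos (2 * Real.pi * ⟪ξ, y⟫) :=
        integral_integral_swap (sgn_D4 hη h0 h3 hn y)
    _ = ∫ ξ : En n, ∫ u in Set.Ioi (0 : ℝ), u⁻¹ * Real.exp (-Real.pi * (‖ξ‖ ^ 2 / u ^ 2)) *
      η (u ^ 2) * Real.cos (2 * Real.pi * ⟪ξ, y⟫) := by
        refine integral_congr_ae ?_
        have : ∀ᵐ ξ : En n, ξ ≠ 0 := by
          simp [ae_iff, measure_singleton]
        filter_upwards [this] with ξ hξ
        rw [integral_mul_const, integral_mul_const, sgn_D1 η (norm_pos_iff.2 hξ)]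
    _ = ∫ u in Set.Ioi (0 : ℝ), ∫ ξ : En n, u⁻¹ * Real.exp (-Real.pi * (‖ξ‖ ^ 2 / u ^ 2)) *
      η (u ^ 2) * Real.cos (2 * Real.pi * ⟪ξ, y⟫) :=
        (integral_integral_swap (sgn_D5 hη h0 h3 hn y)).symm
    _ = _ := by
        refine setIntegral_congr_fun measurableSet_Ioi fun u hu => ?_
        have hu : 0 < u := hu
        have : ∀ ξ : En n, u⁻¹ * Real.exp (-Real.pi * (‖ξ‖ ^ 2 / u ^ 2)) *
          η (u ^ 2) * Real.cos (2 * Real.pi * ⟪ξ, y⟫) = u⁻¹ * η (u ^ 2) *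
          (Real.exp (-Real.pi * (‖ξ‖ ^ 2 / u ^ 2)) * Real.cos (2 * Real.pi * ⟪ξ, y⟫)) :=
            fun ξ => by ring
        simp only [this]
        rw [integral_const_mul, sgn_D3 y hu, hpw u hu]
        ring


theorem sgn_L6 {n p : ℕ} (hp : 1 ≤ p) (hpn : p ≤ n) {K F : En n → ℝ}
    (hK : AEStronglyMeasurable K volume) (hF : Continuous F)
    (hh : ∀ s : ℝ, 0 < s → ∀ x : En n, x ≠ 0 → K x = s ^ p * K (s • x))
    (hKF : Integrable (fun x => K x * F x)) :
    Integrable (fun x => K x * ∫ s in Set.Ioi (0 : ℝ),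
      s ^ (n - 1) * Real.exp (-Real.pi * s ^ 2) * F (s • x)) ∧
    ∫ x, K x * ∫ s in Set.Ioi (0 : ℝ),
      s ^ (n - 1) * Real.exp (-Real.pi * s ^ 2) * F (s • x) =
    (∫ s in Set.Ioi (0 : ℝ), s ^ (p - 1) * Real.exp (-Real.pi * s ^ 2)) * ∫ x, K x * F x := by
  have : Nonempty (Fin n) := ⟨⟨0, hp.trans hpn⟩⟩
  have hne : ∀ᵐ ξ : En n, ξ ≠ 0 := by
    simp [ae_iff, measure_singleton]
  have hcong : ∀ s : ℝ, 0 < s → (fun x => K x * F (s • x)) =ᵐ[volume]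
      fun x => s ^ p * ((fun z => K z * F z) (s • x)) := by
    intro s hs
    filter_upwards [hne] with x hx
    rw [hh s hs x hx]
    ring
  have hint : ∀ s : ℝ, 0 < s → Integrable (fun x => K x * F (s • x)) := fun s hs =>
    (((integrable_comp_smul_iff volume _ hs.ne').2 hKF).const_mul _).congr (hcong s hs).symm
  have hpw : ∀ s : ℝ, 0 < s → s ^ (n - 1) * (s ^ p * (s ^ n)⁻¹) = s ^ (p - 1) := by
    intro s hs
    obtain ⟨q, rfl⟩ : ∃ k, p = k + 1 := ⟨p - 1, by omega⟩
    obtain ⟨k, rfl⟩ : ∃ k, n = k + 1 := ⟨n - 1, by omega⟩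
    simp only [Nat.add_sub_cancel]
    field_simp
    ring
  have hval : ∀ s : ℝ, 0 < s → ∫ x, s ^ (n - 1) * Real.exp (-Real.pi * s ^ 2) *
      (K x * F (s • x)) = s ^ (p - 1) * Real.exp (-Real.pi * s ^ 2) * ∫ x, K x * F x := by
    intro s hs
    rw [integral_const_mul, integral_congr_ae (hcong s hs), integral_const_mul,
      Measure.integral_comp_smul volume (fun z => K z * F z), finrank_euclideanSpace_fin,
      abs_of_pos (by positivity), smul_eq_mul, ← hpw s hs]
    ring
  have hvaln : ∀ s : ℝ, 0 < s → ∫ x, ‖s ^ (n - 1) * Real.exp (-Real.pi * s ^ 2) *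
      (K x * F (s • x))‖ = s ^ (p - 1) * Real.exp (-Real.pi * s ^ 2) * ∫ x, ‖K x * F x‖ := by
    intro s hs
    have h1 : ∀ x, ‖s ^ (n - 1) * Real.exp (-Real.pi * s ^ 2) * (K x * F (s • x))‖ =
      s ^ (n - 1) * Real.exp (-Real.pi * s ^ 2) * ‖K x * F (s • x)‖ := fun x => by
      rw [norm_mul, Real.norm_of_nonneg (by positivity)]
    have h2 : (fun x => ‖K x * F (s • x)‖) =ᵐ[volume]
      fun x => s ^ p * ((fun z => ‖K z * F z‖) (s • x)) := by
      filter_upwards [hcong s hs] with x hx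
      rw [hx, norm_mul, Real.norm_of_nonneg (by positivity : 0 ≤ s ^ p)]
    simp only [h1]
    rw [integral_const_mul, integral_congr_ae h2, integral_const_mul,
      Measure.integral_comp_smul volume (fun z => ‖K z * F z‖), finrank_euclideanSpace_fin,
      abs_of_pos (by positivity), smul_eq_mul, ← hpw s hs]
    ring
  have hG : Integrable (fun q : ℝ × En n => q.1 ^ (n - 1) * Real.exp (-Real.pi * q.1 ^ 2) *
      (K q.2 * F (q.1 • q.2))) ((volume.restrict (Set.Ioi (0 : ℝ))).prod volume) := by
    rw [integrable_prod_iff]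
    · constructor
      · filter_upwards [ae_restrict_mem measurableSet_Ioi] with s hs
        exact (hint s hs).const_mul _
      · refine IntegrableOn.congr_fun (f := fun s : ℝ => s ^ (p - 1) * Real.exp (-Real.pi * s ^ 2) *
          ∫ x, ‖K x * F x‖) ?_ (fun s hs => (hvaln s hs).symm) measurableSet_Ioi
        refine Integrable.mul_const ?_ _
        have := (integrable_rpow_mul_exp_neg_mul_sq Real.pi_pos (s := ((p - 1 : ℕ) : ℝ)) (by
          have : (0 : ℝ) ≤ ((p - 1 : ℕ) : ℝ) := Nat.cast_nonneg _
          linarith)).integrableOn (s := Set.Ioi 0)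
        simpa only [Real.rpow_natCast, IntegrableOn] using this
    · refine AEStronglyMeasurable.mul (Continuous.aestronglyMeasurable (by fun_prop)) ?_
      refine AEStronglyMeasurable.mul hK.comp_snd (Continuous.aestronglyMeasurable (by fun_prop))
  have e : ∀ x, ∫ s in Set.Ioi (0 : ℝ), s ^ (n - 1) * Real.exp (-Real.pi * s ^ 2) *
      (K x * F (s • x)) = K x * ∫ s in Set.Ioi (0 : ℝ),
      s ^ (n - 1) * Real.exp (-Real.pi * s ^ 2) * F (s • x) := by
    intro x
    rw [← integral_const_mul]
    congr 1
    funext s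
    ring
  constructor
  · have := hG.integral_prod_right
    simpa only [e] using this
  · simp only [← e]
    rw [← integral_integral_swap hG, ← integral_mul_const]
    exact setIntegral_congr_fun measurableSet_Ioi fun s hs => hval s hs



open SchwartzMap ContDiff FourierTransform in
theorem sgn_fourier_cos {n : ℕ} {g : En n → ℝ}
    (hs : Continuous g) (hc : HasCompactSupport g) (w : En n) :
    (𝓕 (fun ζ => (g ζ : ℂ)) w).re = ∫ ξ, g ξ * Real.cos (2 * Real.pi * ⟪ξ, w⟫) := by
  have hi : Integrable (fun ζ => (g ζ : ℂ)) := (hs.integrable_of_hasCompactSupport hc).ofReal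
  have h1 := (Real.fourierIntegral_convergent_iff w).2 hi
  rw [Real.fourier_eq, ← Complex.reCLM_apply, ← Complex.reCLM.integral_comp_comm h1]
  congr 1
  funext v
  rw [Circle.smul_def, smul_eq_mul, Complex.reCLM_apply, mul_comm, Complex.re_ofReal_mul,
    Real.fourierChar_apply, Complex.exp_ofReal_mul_I_re, mul_neg, Real.cos_neg]

theorem sgn_cp_pos (k : ℕ) :
    0 < ∫ s in Set.Ioi (0 : ℝ), s ^ k * Real.exp (-Real.pi * s ^ 2) := by
  have hint : IntegrableOn (fun s : ℝ => s ^ k * Real.exp (-Real.pi * s ^ 2)) (Set.Ioi 0) := by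
    have := (integrable_rpow_mul_exp_neg_mul_sq Real.pi_pos (s := (k : ℝ)) (by
      have : (0 : ℝ) ≤ (k : ℝ) := Nat.cast_nonneg _
      linarith)).integrableOn (s := Set.Ioi 0)
    simpa only [Real.rpow_natCast] using this
  rw [setIntegral_pos_iff_support_of_nonneg_ae _ hint]
  · have : Function.support (fun s : ℝ => s ^ k * Real.exp (-Real.pi * s ^ 2)) ∩ Set.Ioi 0
        = Set.Ioi 0 := by
      refine Set.inter_eq_right.2 fun s hs => ?_
      have hs : 0 < s := hs
      exact (by positivity : 0 < s ^ k * Real.exp (-Real.pi * s ^ 2)).ne'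
    rw [this]
    simp
  · filter_upwards [ae_restrict_mem measurableSet_Ioi] with s hs
    have hs : 0 < s := hs
    simp only [Pi.zero_apply]
    positivity

theorem sgn_W_mono {n : ℕ} {η : ℝ → ℝ} (hη : Continuous η) (h0 : ∀ t, 0 ≤ η t)
    (h3 : ∀ t, 3 ≤ t → η t = 0) {a b : ℝ} (ha : 0 ≤ a) (hab : a ≤ b) :
    ∫ u in Set.Ioi (0 : ℝ), u ^ (n - 1) * η (u ^ 2) * Real.exp (-Real.pi * (u ^ 2 * b ^ 2)) ≤
    ∫ u in Set.Ioi (0 : ℝ), u ^ (n - 1) * η (u ^ 2) * Real.exp (-Real.pi * (u ^ 2 * a ^ 2)) := by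
  have hi : ∀ c : ℝ, IntegrableOn (fun u : ℝ => u ^ (n - 1) * η (u ^ 2) *
      Real.exp (-Real.pi * (u ^ 2 * c ^ 2))) (Set.Ioi 0) := by
    intro c
    refine Integrable.integrableOn ?_
    refine Continuous.integrable_of_hasCompactSupport (by fun_prop) ?_
    refine HasCompactSupport.intro (isCompact_closedBall (0 : ℝ) 2) fun x hx => ?_
    have hx : 2 < |x| := by simpa using hx
    rw [h3, mul_zero, zero_mul]
    rw [← sq_abs]
    nlinarith
  refine setIntegral_mono_on (hi b) (hi a) measurableSet_Ioi fun u hu => ?_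
  have hu : 0 < u := hu
  refine mul_le_mul_of_nonneg_left ?_ (mul_nonneg (by positivity) (h0 _))
  rw [Real.exp_le_exp]
  have : u ^ 2 * a ^ 2 ≤ u ^ 2 * b ^ 2 := by gcongr
  nlinarith [Real.pi_pos]

open SchwartzMap ContDiff FourierTransform in
theorem sgn_L7 {n m p : ℕ} (hp : 1 ≤ p) (hpn : p ≤ n)
    {A : (Fin (2*m) → Fin n) → ℝ} {K : En n → ℝ}
    (hQ : ∀ ξ : En n, ξ ≠ 0 → 0 < symbolQ n m A ξ)
    (hl : LocallyIntegrable K volume)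
    (hK : Integrable (fun x => K x * (1 + ‖x‖) ^ (-(n + 1 : ℝ))))
    (hh : ∀ s : ℝ, 0 < s → ∀ x : En n, x ≠ 0 → K x = s ^ p * K (s • x))
    (hf : IsFundamentalSolution n m A K) (M : En n ≃L[ℝ] En n)
    (hM : ∀ x y, ⟪M x, y⟫ = ⟪x, M y⟫) {η : ℝ → ℝ}
    (hη : ContDiff ℝ ∞ η) (h0 : ∀ t, 0 ≤ η t)
    (h3 : ∀ t, 3 ≤ t → η t = 0) (h1 : ∀ t, t ≤ 1 → η t = 0) :
    Integrable (fun x => K x * ∫ u in Set.Ioi (0 : ℝ), u ^ (n - 1) * η (u ^ 2) *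
      Real.exp (-Real.pi * (u ^ 2 * ‖M x‖ ^ 2))) ∧
    (2 * Real.pi) ^ (2 * m) * ∫ x, K x * (∫ u in Set.Ioi (0 : ℝ), u ^ (n - 1) * η (u ^ 2) *
      Real.exp (-Real.pi * (u ^ 2 * ‖M x‖ ^ 2))) =
      (∫ s in Set.Ioi (0 : ℝ), s ^ (p - 1) * Real.exp (-Real.pi * s ^ 2)) *
      ∫ ζ : En n, η (‖ζ‖ ^ 2) / symbolQ n m A (M ζ) := by
  have hs : ContDiff ℝ ∞ (fun ξ : En n => η (‖ξ‖ ^ 2)) := hη.comp (contDiff_norm_sq ℝ)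
  have hc : HasCompactSupport (fun ξ : En n => η (‖ξ‖ ^ 2)) := by
    refine HasCompactSupport.intro (isCompact_closedBall (0 : En n) 2) fun x hx => h3 _ ?_
    have hx : 2 < ‖x‖ := by simpa using hx
    nlinarith
  have hz : (0 : En n) ∉ tsupport (fun ξ : En n => η (‖ξ‖ ^ 2)) := by
    rw [notMem_tsupport_iff_eventuallyEq]
    filter_upwards [Metric.ball_mem_nhds (0 : En n) one_pos] with x hx
    have hx : ‖x‖ < 1 := by simpa using hx
    refine h1 _ ?_
    nlinarith [norm_nonneg x]
  obtain ⟨hi, hid⟩ := sgn_identity hQ hl hK hf M hM hs hc hz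
  obtain ⟨φ, hφ⟩ := sgn_schw_exists hs hc M
  have hcont : Continuous (fun x => (𝓕 (fun ζ : En n => ((η (‖ζ‖ ^ 2) : ℝ) : ℂ)) (M x)).re) := by
    exact (funext hφ : (φ : En n → ℝ) = _) ▸ φ.continuous
  obtain ⟨h5, h6⟩ := sgn_L6 hp hpn hl.aestronglyMeasurable hcont hh hi
  have e : ∀ x, ∫ s in Set.Ioi (0 : ℝ), s ^ (n - 1) * Real.exp (-Real.pi * s ^ 2) *
      (𝓕 (fun ζ : En n => ((η (‖ζ‖ ^ 2) : ℝ) : ℂ)) (M (s • x))).re =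
      ∫ u in Set.Ioi (0 : ℝ), u ^ (n - 1) * η (u ^ 2) *
      Real.exp (-Real.pi * (u ^ 2 * ‖M x‖ ^ 2)) := by
    intro x
    rw [← sgn_L5 hη.continuous h0 h3 (hp.trans hpn) (M x)]
    congr 1
    funext s
    rw [sgn_fourier_cos hs.continuous hc, map_smul]
  simp only [e] at h5 h6
  refine ⟨h5, ?_⟩
  rw [h6, ← hid]
  ring

open SchwartzMap ContDiff FourierTransform in
theorem sgn_sign {n m p : ℕ} (hp : 1 ≤ p) (hpn : p ≤ n)
    {A : (Fin (2*m) → Fin n) → ℝ} {K : En n → ℝ}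
    (hQ : ∀ ξ : En n, ξ ≠ 0 → 0 < symbolQ n m A ξ)
    (hl : LocallyIntegrable K volume)
    (hK : Integrable (fun x => K x * (1 + ‖x‖) ^ (-(n + 1 : ℝ))))
    (hh : ∀ s : ℝ, 0 < s → ∀ x : En n, x ≠ 0 → K x = s ^ p * K (s • x))
    (hf : IsFundamentalSolution n m A K) {η : ℝ → ℝ}
    (hη : ContDiff ℝ ∞ η) (h0 : ∀ t, 0 ≤ η t)
    (h3 : ∀ t, 3 ≤ t → η t = 0) (h1 : ∀ t, t ≤ 1 → η t = 0) :
    ((∀ x, x ≠ 0 → K x ≤ 0) → ∫ ζ : En n, η (‖ζ‖ ^ 2) / symbolQ n m A ζ ≤ 0) ∧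
    ((∀ x, x ≠ 0 → 0 ≤ K x) → ∀ (M : En n ≃L[ℝ] En n), (∀ x y, ⟪M x, y⟫ = ⟪x, M y⟫) →
      (∀ x, ‖M x‖ ≤ ‖x‖) → ∫ ζ : En n, η (‖ζ‖ ^ 2) / symbolQ n m A ζ ≤
        ∫ ζ : En n, η (‖ζ‖ ^ 2) / symbolQ n m A (M ζ)) := by
  have : Nonempty (Fin n) := ⟨⟨0, hp.trans hpn⟩⟩
  have hne : ∀ᵐ ξ : En n, ξ ≠ 0 := by
    simp [ae_iff, measure_singleton]
  have hcp := sgn_cp_pos (p - 1)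
  obtain ⟨i1, e1⟩ := sgn_L7 hp hpn hQ hl hK hh hf (ContinuousLinearEquiv.refl ℝ (En n))
    (fun _ _ => rfl) hη h0 h3 h1
  simp only [ContinuousLinearEquiv.refl_apply] at i1 e1
  have hpi : 0 < (2 * Real.pi) ^ (2 * m) := by positivity
  constructor
  · intro hneg
    have h2 : ∫ x, K x * (∫ u in Set.Ioi (0 : ℝ), u ^ (n - 1) * η (u ^ 2) *
      Real.exp (-Real.pi * (u ^ 2 * ‖x‖ ^ 2))) ≤ 0 := by
      refine integral_nonpos_of_ae ?_
      filter_upwards [hne] with x hx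
      refine mul_nonpos_of_nonpos_of_nonneg (hneg x hx) ?_
      refine setIntegral_nonneg measurableSet_Ioi fun u hu => ?_
      have hu : 0 < u := hu
      have := h0 (u ^ 2)
      positivity
    by_contra hcon
    push Not at hcon
    have := mul_pos hcp hcon
    rw [← e1] at this
    nlinarith
  · intro hpos M hM hle
    obtain ⟨i2, e2⟩ := sgn_L7 hp hpn hQ hl hK hh hf M hM hη h0 h3 h1
    have h2 := integral_mono_ae i1 i2 (by
      filter_upwards [hne] with x hx
      exact mul_le_mul_of_nonneg_left
        (sgn_W_mono hη.continuous h0 h3 (norm_nonneg _) (hle x)) (hpos x hx))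
    have h4 := mul_le_mul_of_nonneg_left h2 hpi.le
    rw [e1, e2] at h4
    exact le_of_mul_le_mul_left h4 hcp



/-- `f` is given by a `k`-homogeneous coefficient array. -/
def SgnRep (n k : ℕ) (f : En n → ℝ) : Prop :=
  ∃ A : (Fin k → Fin n) → ℝ, ∀ ξ, ∑ i : Fin k → Fin n, A i * ∏ j, ξ (i j) = f ξ

theorem SgnRep.add {n k : ℕ} {f g : En n → ℝ} (hf : SgnRep n k f) (hg : SgnRep n k g) :
    SgnRep n k (fun ξ => f ξ + g ξ) := by
  obtain ⟨A, hA⟩ := hf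
  obtain ⟨B, hB⟩ := hg
  refine ⟨fun i => A i + B i, fun ξ => ?_⟩
  beta_reduce
  rw [← hA, ← hB, ← Finset.sum_add_distrib]
  exact Finset.sum_congr rfl fun i _ => by ring

theorem SgnRep.smul {n k : ℕ} {f : En n → ℝ} (hf : SgnRep n k f) (c : ℝ) :
    SgnRep n k (fun ξ => c * f ξ) := by
  obtain ⟨A, hA⟩ := hf
  refine ⟨fun i => c * A i, fun ξ => ?_⟩
  beta_reduce
  rw [← hA, Finset.mul_sum]
  exact Finset.sum_congr rfl fun i _ => by ring

theorem SgnRep.mul {n k l : ℕ} {f g : En n → ℝ} (hf : SgnRep n k f) (hg : SgnRep n l g) :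
    SgnRep n (k + l) (fun ξ => f ξ * g ξ) := by
  obtain ⟨A, hA⟩ := hf
  obtain ⟨B, hB⟩ := hg
  refine ⟨fun i => A (fun j => i (Fin.castAdd l j)) * B (fun j => i (Fin.natAdd k j)),
    fun ξ => ?_⟩
  beta_reduce
  rw [← hA, ← hB, Finset.sum_mul_sum, ← Finset.sum_product', Finset.univ_product_univ]
  refine (Fintype.sum_equiv (Fin.appendEquiv k l) _ _ fun x => ?_).symm
  rw [Fin.prod_univ_add]
  simp [Fin.appendEquiv]
  ring

theorem SgnRep.one {n : ℕ} : SgnRep n 0 (fun _ => 1) :=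
  ⟨fun _ => 1, fun ξ => by simp⟩

theorem SgnRep.zero {n k : ℕ} : SgnRep n k (fun _ => 0) :=
  ⟨fun _ => 0, fun ξ => by simp⟩

theorem SgnRep.pow {n k : ℕ} {f : En n → ℝ} (hf : SgnRep n k f) (j : ℕ) :
    SgnRep n (j * k) (fun ξ => f ξ ^ j) := by
  induction j with
  | zero => simpa using SgnRep.one
  | succ j ih =>
    rw [Nat.succ_mul]
    simpa only [pow_succ] using ih.mul hf

theorem SgnRep.sum {n k : ℕ} {ι : Type} (s : Finset ι) {f : ι → En n → ℝ}
    (hf : ∀ i, SgnRep n k (f i)) : SgnRep n k (fun ξ => ∑ i ∈ s, f i ξ) := by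
  classical
  induction s using Finset.induction_on with
  | empty => simpa using SgnRep.zero
  | insert a s ha ih =>
    simp only [Finset.sum_insert ha]
    exact (hf a).add ih

theorem SgnRep.coord {n : ℕ} (i : Fin n) : SgnRep n 1 (fun ξ => ξ i) := by
  classical
  refine ⟨fun v => if v 0 = i then 1 else 0, fun ξ => ?_⟩
  rw [Fintype.sum_equiv (Equiv.funUnique (Fin 1) (Fin n)) _
    (fun a => (if a = i then (1 : ℝ) else 0) * ξ a) (fun x => by simp)]
  simp

/-- Sum of squares of the coordinates other than the zeroth. -/
def sgnR {d : ℕ} (ξ : En (d + 1)) : ℝ := ∑ i : Fin d, ξ i.succ ^ 2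

/-- The symbol used in the counterexample. -/
def sgnQ {d : ℕ} (m : ℕ) (δ : ℝ) (ξ : En (d + 1)) : ℝ :=
  sgnR ξ ^ (m - 2) * (sgnR ξ - ξ 0 ^ 2) ^ 2 + δ * ξ 0 ^ (2 * m)

theorem sgnR_nonneg {d : ℕ} (ξ : En (d + 1)) : 0 ≤ sgnR ξ :=
  Finset.sum_nonneg fun _ _ => sq_nonneg _

theorem sgn_norm_sq {d : ℕ} (ξ : En (d + 1)) : ‖ξ‖ ^ 2 = ξ 0 ^ 2 + sgnR ξ := by
  rw [EuclideanSpace.real_norm_sq_eq, Fin.sum_univ_succ]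
  rfl

theorem sgnR_cont {d : ℕ} : Continuous (sgnR (d := d)) := by
  unfold sgnR
  fun_prop

theorem sgnQ_cont {d m : ℕ} {δ : ℝ} : Continuous (sgnQ (d := d) m δ) := by
  have := sgnR_cont (d := d)
  unfold sgnQ
  fun_prop

theorem sgnQ_pos {d m : ℕ} {δ : ℝ} (hδ : 0 < δ) (ξ : En (d + 1)) (hξ : ξ ≠ 0) :
    0 < sgnQ m δ ξ := by
  have hR := sgnR_nonneg ξ
  have h2 : 0 ≤ sgnR ξ ^ (m - 2) * (sgnR ξ - ξ 0 ^ 2) ^ 2 := by positivity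
  have h3 : 0 ≤ δ * ξ 0 ^ (2 * m) := mul_nonneg hδ.le ((even_two_mul m).pow_nonneg _)
  unfold sgnQ
  by_cases h : ξ 0 = 0
  · have : 0 < sgnR ξ := by
      have h1 := sgn_norm_sq ξ
      rw [h] at h1
      have : 0 < ‖ξ‖ ^ 2 := by positivity
      nlinarith
    refine add_pos_of_pos_of_nonneg ?_ h3
    rw [h]
    have : 0 < (sgnR ξ - 0 ^ 2) := by simpa
    positivity
  · exact add_pos_of_nonneg_of_pos h2 (mul_pos hδ ((even_two_mul m).pow_pos h))

theorem sgnQ_rep {d m : ℕ} (hm : 2 ≤ m) (δ : ℝ) : ∃ A : (Fin (2*m) → Fin (d + 1)) → ℝ,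
    ∀ ξ, symbolQ (d + 1) m A ξ = sgnQ m δ ξ := by
  have hR : SgnRep (d + 1) 2 sgnR :=
    SgnRep.sum Finset.univ fun i : Fin d => (SgnRep.coord (n := d + 1) i.succ).pow 2
  have ht := (SgnRep.coord (n := d + 1) 0).pow 2
  have h1 := ((hR.add (ht.smul (-1))).pow 2)
  have h2 := (hR.pow (m - 2)).mul h1
  have h3 := ((SgnRep.coord (n := d + 1) 0).pow (2 * m)).smul δ
  rw [mul_one] at h3
  rw [show (m - 2) * 2 + 2 * 2 = 2 * m by omega] at h2
  obtain ⟨A, hA⟩ := h2.add h3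
  refine ⟨A, fun ξ => ?_⟩
  unfold symbolQ sgnQ
  rw [hA]
  ring

theorem sgn_ellip {n m : ℕ} (hn : 1 ≤ n) (hm : 1 ≤ m) {A : (Fin (2*m) → Fin n) → ℝ}
    (hQ : ∀ ξ : En n, ξ ≠ 0 → 0 < symbolQ n m A ξ) :
    ∃ lam : ℝ, 0 < lam ∧ ∀ ξ : En n, lam * ‖ξ‖ ^ (2 * m) ≤ symbolQ n m A ξ := by
  have : Nonempty (Fin n) := ⟨⟨0, hn⟩⟩
  have hcont : Continuous (symbolQ n m A) := by
    unfold symbolQ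
    fun_prop
  obtain ⟨v, hv⟩ : (Metric.sphere (0 : En n) 1).Nonempty := NormedSpace.sphere_nonempty.2 zero_le_one
  obtain ⟨w, hw, hmin⟩ := (isCompact_sphere (0 : En n) 1).exists_isMinOn ⟨v, hv⟩ hcont.continuousOn
  have hw0 : w ≠ 0 := by
    rintro rfl
    simp at hw
  refine ⟨symbolQ n m A w, hQ w hw0, fun ξ => ?_⟩
  have hhom : ∀ (c : ℝ) (ζ : En n), symbolQ n m A (c • ζ) = c ^ (2 * m) * symbolQ n m A ζ := by
    intro c ζ
    unfold symbolQ
    rw [Finset.mul_sum]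
    refine Finset.sum_congr rfl fun i _ => ?_
    simp only [PiLp.smul_apply, smul_eq_mul, Finset.prod_mul_distrib, Finset.prod_const,
      Finset.card_univ, Fintype.card_fin]
    ring
  by_cases h : ξ = 0
  · have h0 := hhom 0 0
    rw [smul_zero] at h0
    rw [h, norm_zero, zero_pow (by omega), mul_zero, h0, zero_pow (by omega), zero_mul]
  · have hpos : 0 < ‖ξ‖ := norm_pos_iff.2 h
    have h1 : ξ = ‖ξ‖ • (‖ξ‖⁻¹ • ξ) := by rw [smul_smul, mul_inv_cancel₀ hpos.ne', one_smul]
    have h2 : ‖ξ‖⁻¹ • ξ ∈ Metric.sphere (0 : En n) 1 := by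
      simp [norm_smul, hpos.ne']
    have h3 : symbolQ n m A w ≤ symbolQ n m A (‖ξ‖⁻¹ • ξ) := hmin h2
    calc _ ≤ symbolQ n m A (‖ξ‖⁻¹ • ξ) * ‖ξ‖ ^ (2 * m) := by gcongr
      _ = symbolQ n m A (‖ξ‖ • (‖ξ‖⁻¹ • ξ)) := by rw [hhom ‖ξ‖ (‖ξ‖⁻¹ • ξ), mul_comm]
      _ = _ := by rw [← h1]



theorem sgn_ae_coord {d : ℕ} : ∀ᵐ ζ : En (d + 1), ∀ i, ζ i ≠ 0 := by
  rw [ae_all_iff]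
  intro i
  have h := Measure.ae_eval_ne (fun _ : Fin (d + 1) => (volume : Measure ℝ)) i 0
  rw [← volume_pi] at h
  exact (PiLp.volume_preserving_ofLp (Fin (d + 1))).quasiMeasurePreserving.ae h

theorem sgn_H1 {d m : ℕ} (hd : 2 * m + 1 ≤ d) {η : ℝ → ℝ} (hη : Continuous η) (h0 : ∀ t, 0 ≤ η t)
    (h1 : ∀ t, η t ≤ 1) (h3 : ∀ t, 3 ≤ t → η t = 0) :
    Integrable (fun ζ : En (d + 1) => η (‖ζ‖ ^ 2) / sgnR ζ ^ m) := by
  have hd0 : (0 : ℝ) < d := by exact_mod_cast (by omega : 0 < d)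
  set c : Fin (d + 1) → ℝ := Fin.cons 0 (fun _ => 2 * m / d) with hc
  have hc1 : ∀ i, c i < 1 := by
    intro i
    refine Fin.cases ?_ (fun i => ?_) i
    · simp [hc]
    · simp only [hc, Fin.cons_succ]
      rw [div_lt_one hd0]
      exact_mod_cast (by omega : 2 * m < d)
  set f : Fin (d + 1) → ℝ → ℝ := fun i =>
    Set.indicator (Metric.ball 0 2) (fun t => |t| ^ (-(c i))) with hf
  have hfi : ∀ i, Integrable (f i) := by
    intro i
    rw [hf, integrable_indicator_iff Metric.isOpen_ball.measurableSet]
    refine integrableOn_ball_of_norm_le_rpow (C := 1) (α := c i) (by simp) (by simpa using hc1 i)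
      (ae_of_all _ fun t => ?_) ?_
    · rw [one_mul, Real.norm_eq_abs, Real.norm_eq_abs, abs_of_nonneg (by positivity)]
    · refine Measurable.aestronglyMeasurable ?_
      fun_prop
  have hP : Integrable (fun x : Fin (d + 1) → ℝ => ∏ i, f i (x i)) := Integrable.fintype_prod hfi
  have hP2 : Integrable (fun ζ : En (d + 1) => ∏ i, f i (ζ i)) :=
    (PiLp.volume_preserving_ofLp (Fin (d + 1))).integrable_comp_of_integrable hP
  have hmeas : Measurable (fun ζ : En (d + 1) => η (‖ζ‖ ^ 2) / sgnR ζ ^ m) := by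
    have := hη.measurable
    have := (sgnR_cont (d := d)).measurable
    fun_prop
  refine hP2.mono' hmeas.aestronglyMeasurable ?_
  filter_upwards [sgn_ae_coord] with ζ hζ
  have hR0 := sgnR_nonneg ζ
  rw [Real.norm_of_nonneg (div_nonneg (h0 _) (by positivity))]
  have hfn : ∀ i t, 0 ≤ f i t := fun i t => Set.indicator_nonneg (fun t _ => by positivity) t
  by_cases h : 3 ≤ ‖ζ‖ ^ 2
  · rw [h3 _ h, zero_div]
    exact Finset.prod_nonneg fun i _ => hfn _ _
  push Not at h
  have hsmall : ∀ i, ζ i ∈ Metric.ball (0 : ℝ) 2 := by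
    intro i
    have := PiLp.norm_apply_le ζ i
    rw [mem_ball_zero_iff]
    nlinarith [norm_nonneg ζ]
  have e : ∏ i, f i (ζ i) = ∏ i : Fin d, |ζ i.succ| ^ (-(2 * m / d : ℝ)) := by
    rw [Fin.prod_univ_succ]
    simp only [hf, Set.indicator_of_mem (hsmall _)]
    simp [hc]
  have hle : ∀ i : Fin d, ζ i.succ ^ 2 ≤ sgnR ζ := fun i =>
    Finset.single_le_sum (f := fun i : Fin d => ζ i.succ ^ 2) (fun _ _ => sq_nonneg _)
      (Finset.mem_univ i)
  have hRpos : 0 < sgnR ζ := by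
    refine lt_of_lt_of_le ?_ (hle ⟨0, by omega⟩)
    have := hζ (Fin.succ ⟨0, by omega⟩)
    positivity
  have hprod : ∏ i : Fin d, |ζ i.succ| ^ (2 * m / d : ℝ) ≤ sgnR ζ ^ m := by
    calc _ ≤ ∏ i : Fin d, sgnR ζ ^ (m / d : ℝ) := by
          refine Finset.prod_le_prod (fun i _ => by positivity) fun i _ => ?_
          have : |ζ i.succ| ^ (2 * m / d : ℝ) = (ζ i.succ ^ 2) ^ (m / d : ℝ) := by
            rw [← sq_abs, ← Real.rpow_natCast, ← Real.rpow_mul (abs_nonneg _)]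
            congr 1
            push_cast
            ring
          rw [this]
          exact Real.rpow_le_rpow (sq_nonneg _) (hle i) (by positivity)
      _ = _ := by
          rw [Finset.prod_const, Finset.card_univ, Fintype.card_fin, ← Real.rpow_natCast,
            ← Real.rpow_mul hR0, div_mul_cancel₀ _ hd0.ne', Real.rpow_natCast]
  rw [e]
  have e2 : ∏ i : Fin d, |ζ i.succ| ^ (-(2 * m / d : ℝ)) =
      (∏ i : Fin d, |ζ i.succ| ^ (2 * m / d : ℝ))⁻¹ := by
    rw [← Finset.prod_inv_distrib]
    exact Finset.prod_congr rfl fun i _ => Real.rpow_neg (abs_nonneg _) _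
  rw [e2]
  have hpp : 0 < ∏ i : Fin d, |ζ i.succ| ^ (2 * m / d : ℝ) :=
    Finset.prod_pos fun i _ => Real.rpow_pos_of_pos (abs_pos.2 (hζ _)) _
  calc _ ≤ 1 / sgnR ζ ^ m := by gcongr; exact h1 _
    _ ≤ _ := by rw [one_div]; gcongr

/-- The diagonal map scaling the zeroth coordinate by `ε`. -/
def sgnM (d : ℕ) (ε : ℝ) (hε : 0 < ε) : En (d + 1) ≃L[ℝ] En (d + 1) :=
  LinearEquiv.toContinuousLinearEquiv
    { toFun := fun x => WithLp.toLp 2 (fun i => (if i = 0 then ε else 1) * x i)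
      invFun := fun x => WithLp.toLp 2 (fun i => (if i = 0 then ε else 1)⁻¹ * x i)
      map_add' := fun x y => by ext i; simp [mul_add]
      map_smul' := fun c x => by
        ext i
        simp only [PiLp.smul_apply, smul_eq_mul, RingHom.id_apply]
        ring
      left_inv := fun x => by
        ext i
        by_cases h : i = 0 <;> simp [h, hε.ne']
      right_inv := fun x => by
        ext i
        by_cases h : i = 0 <;> simp [h, hε.ne'] }

theorem sgnM_apply {d : ℕ} {ε : ℝ} (hε : 0 < ε) (x : En (d + 1)) (i : Fin (d + 1)) :
    sgnM d ε hε x i = (if i = 0 then ε else 1) * x i := rfl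

theorem sgnM_R {d : ℕ} {ε : ℝ} (hε : 0 < ε) (x : En (d + 1)) :
    sgnR (sgnM d ε hε x) = sgnR x := by
  unfold sgnR
  refine Finset.sum_congr rfl fun i _ => ?_
  rw [sgnM_apply, if_neg (Fin.succ_ne_zero i), one_mul]

theorem sgnM_zero {d : ℕ} {ε : ℝ} (hε : 0 < ε) (x : En (d + 1)) :
    sgnM d ε hε x 0 = ε * x 0 := by
  rw [sgnM_apply, if_pos rfl]

theorem sgnM_symm {d : ℕ} {ε : ℝ} (hε : 0 < ε) (x y : En (d + 1)) :
    ⟪sgnM d ε hε x, y⟫ = ⟪x, sgnM d ε hε y⟫ := by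
  rw [PiLp.inner_apply, PiLp.inner_apply]
  refine Finset.sum_congr rfl fun i _ => ?_
  rw [sgnM_apply, sgnM_apply]
  simp only [RCLike.inner_apply, conj_trivial]
  ring

theorem sgnM_norm {d : ℕ} {ε : ℝ} (hε : 0 < ε) (hε1 : ε ≤ 1) (x : En (d + 1)) :
    ‖sgnM d ε hε x‖ ≤ ‖x‖ := by
  refine le_of_sq_le_sq ?_ (norm_nonneg _)
  rw [sgn_norm_sq, sgn_norm_sq, sgnM_R, sgnM_zero, mul_pow]
  have : ε ^ 2 ≤ 1 := pow_le_one₀ hε.le hε1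
  nlinarith [sq_nonneg (x 0)]

open Filter Topology in
theorem sgn_H2 {d m : ℕ} (hm : 2 ≤ m) (hd : 2 * m + 1 ≤ d) {η : ℝ → ℝ} (hη : Continuous η)
    (h0 : ∀ t, 0 ≤ η t) (h1 : ∀ t, η t ≤ 1) (h3 : ∀ t, 3 ≤ t → η t = 0) {δ lam : ℝ}
    (hlam : 0 < lam)
    (hell : ∀ ξ : En (d + 1), lam * ‖ξ‖ ^ (2 * m) ≤ sgnQ m δ ξ) {I : ℝ}
    (hI : ∀ (ε : ℝ) (hε : 0 < ε), ε ≤ 1 →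
      I ≤ ∫ ζ : En (d + 1), η (‖ζ‖ ^ 2) / sgnQ m δ (sgnM d ε hε ζ)) :
    I ≤ ∫ ζ : En (d + 1), η (‖ζ‖ ^ 2) / sgnR ζ ^ m := by
  have hint := sgn_H1 hd hη h0 h1 h3
  have hpos : ∀ k : ℕ, (0 : ℝ) < 1 / ((k : ℝ) + 1) := fun k => by positivity
  have hlim : Tendsto (fun k : ℕ => ∫ ζ : En (d + 1),
      η (‖ζ‖ ^ 2) / sgnQ m δ (sgnM d (1 / ((k : ℝ) + 1)) (hpos k) ζ)) atTop
      (𝓝 (∫ ζ : En (d + 1), η (‖ζ‖ ^ 2) / sgnR ζ ^ m)) := by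
    refine tendsto_integral_of_dominated_convergence
      (fun ζ => lam⁻¹ * (η (‖ζ‖ ^ 2) / sgnR ζ ^ m)) ?_ (hint.const_mul _) ?_ ?_
    · intro k
      refine Measurable.aestronglyMeasurable ?_
      have e1 := hη.measurable
      have e2 := (sgnQ_cont (d := d) (m := m) (δ := δ)).measurable
      have e3 := (sgnM d (1 / ((k : ℝ) + 1)) (hpos k)).continuous.measurable
      fun_prop
    · intro k
      filter_upwards [sgn_ae_coord] with ζ hζ
      have hR0 := sgnR_nonneg ζ
      have hRpos : 0 < sgnR ζ := by
        refine lt_of_lt_of_le ?_ (Finset.single_le_sum (f := fun i : Fin d => ζ i.succ ^ 2)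
          (fun _ _ => sq_nonneg _) (Finset.mem_univ ⟨0, by omega⟩))
        have := hζ (Fin.succ ⟨0, by omega⟩)
        positivity
      have hb : lam * sgnR ζ ^ m ≤ sgnQ m δ (sgnM d (1 / ((k : ℝ) + 1)) (hpos k) ζ) := by
        refine le_trans ?_ (hell _)
        rw [pow_mul, sgn_norm_sq, sgnM_R]
        gcongr
        nlinarith [sq_nonneg (sgnM d (1 / ((k : ℝ) + 1)) (hpos k) ζ 0)]
      have hlp : 0 < lam * sgnR ζ ^ m := by positivity
      rw [Real.norm_of_nonneg (div_nonneg (h0 _) (hlp.le.trans hb))]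
      calc _ ≤ η (‖ζ‖ ^ 2) / (lam * sgnR ζ ^ m) := div_le_div_of_nonneg_left (h0 _) hlp hb
        _ = _ := by field_simp
    · filter_upwards [sgn_ae_coord] with ζ hζ
      have hRpos : 0 < sgnR ζ := by
        refine lt_of_lt_of_le ?_ (Finset.single_le_sum (f := fun i : Fin d => ζ i.succ ^ 2)
          (fun _ _ => sq_nonneg _) (Finset.mem_univ ⟨0, by omega⟩))
        have := hζ (Fin.succ ⟨0, by omega⟩)
        positivity
      refine Tendsto.div tendsto_const_nhds ?_ (by positivity)
      have ht : Tendsto (fun k : ℕ => 1 / ((k : ℝ) + 1) * ζ 0) atTop (𝓝 (0 * ζ 0)) :=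
        tendsto_one_div_add_atTop_nhds_zero_nat.mul_const _
      have hcont : Continuous (fun t : ℝ => sgnR ζ ^ (m - 2) * (sgnR ζ - t ^ 2) ^ 2 +
        δ * t ^ (2 * m)) := by fun_prop
      have := (hcont.tendsto _).comp ht
      have e : sgnR ζ ^ (m - 2) * (sgnR ζ - (0 * ζ 0) ^ 2) ^ 2 + δ * (0 * ζ 0) ^ (2 * m) =
          sgnR ζ ^ m := by
        rw [zero_mul, zero_pow (by omega), zero_pow (by omega), mul_zero, add_zero, sub_zero,
          ← pow_add, Nat.sub_add_cancel hm]
      rw [e] at this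
      refine this.congr fun k => ?_
      simp only [Function.comp_apply, sgnQ, sgnM_R, sgnM_zero]
  refine ge_of_tendsto' hlim fun k => hI _ _ ?_
  rw [div_le_one (by positivity)]
  have : (0 : ℝ) ≤ k := Nat.cast_nonneg _
  linarith



theorem sgn_I1 {d m : ℕ} (hm : 2 ≤ m) {η : ℝ → ℝ} (h2 : ∀ t, 3 / 2 ≤ t → t ≤ 5 / 2 → η t = 1)
    {N : ℝ} (hN : 20 ≤ N) (y : En (d + 1)) (hy : |Real.sqrt (sgnR y) - 1| < 1 / 20)
    (hy0 : |Real.sqrt (sgnR y) - y 0| ≤ 1 / N) :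
    N ^ 2 / (6 * 2 ^ m) ≤ η (‖y‖ ^ 2) / sgnQ m (1 / N ^ 2) y := by
  have hN0 : 0 < N := by linarith
  set ρ := Real.sqrt (sgnR y) with hρ
  have hR : sgnR y = ρ ^ 2 := (Real.sq_sqrt (sgnR_nonneg y)).symm
  set τ := y 0 with hτ
  have hN1 : 1 / N ≤ 1 / 20 := one_div_le_one_div_of_le (by norm_num) hN
  obtain ⟨a1, a2⟩ := abs_lt.1 hy
  obtain ⟨b1, b2⟩ := abs_le.1 (hy0.trans hN1)
  have hsq : (ρ - τ) ^ 2 ≤ 1 / N ^ 2 := by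
    rw [← sq_abs, ← one_div_pow]
    gcongr
  have hn : η (‖y‖ ^ 2) = 1 := by
    rw [sgn_norm_sq, hR]
    refine h2 _ ?_ ?_ <;> nlinarith
  have hyne : y ≠ 0 := by
    intro h
    have : τ = 0 := by rw [hτ, h]; rfl
    linarith
  have hpos : 0 < sgnQ m (1 / N ^ 2) y := sgnQ_pos (by positivity) y hyne
  have hQ : sgnQ m (1 / N ^ 2) y ≤ 6 * 2 ^ m / N ^ 2 := by
    unfold sgnQ
    have c1 : sgnR y ^ (m - 2) ≤ 2 ^ m := by
      calc sgnR y ^ (m - 2) ≤ 2 ^ (m - 2) := by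
            refine pow_le_pow_left₀ (sgnR_nonneg y) ?_ _
            rw [hR]; nlinarith
        _ ≤ 2 ^ m := pow_le_pow_right₀ (by norm_num) (by omega)
    have c2 : (sgnR y - y 0 ^ 2) ^ 2 ≤ 5 * (1 / N ^ 2) := by
      rw [hR, ← hτ, show (ρ ^ 2 - τ ^ 2) ^ 2 = (ρ + τ) ^ 2 * (ρ - τ) ^ 2 by ring]
      refine mul_le_mul ?_ hsq (sq_nonneg _) (by norm_num)
      nlinarith
    have c3 : y 0 ^ (2 * m) ≤ 2 ^ m := by
      rw [pow_mul, ← hτ]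
      refine pow_le_pow_left₀ (sq_nonneg _) ?_ _
      nlinarith
    calc _ ≤ 2 ^ m * (5 * (1 / N ^ 2)) + 1 / N ^ 2 * 2 ^ m := by
          refine add_le_add (mul_le_mul c1 c2 (sq_nonneg _) (by positivity)) ?_
          gcongr
      _ = _ := by ring
  rw [hn]
  calc _ = 1 / (6 * 2 ^ m / N ^ 2) := by rw [one_div_div]
    _ ≤ _ := one_div_le_one_div_of_le hpos hQ

theorem sgn_I2 {d m : ℕ} {η : ℝ → ℝ} (hη : Continuous η)
    (h0 : ∀ t, 0 ≤ η t) (h3 : ∀ t, 3 ≤ t → η t = 0) (h1 : ∀ t, t ≤ 1 → η t = 0) {δ lam : ℝ}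
    (hlam : 0 < lam) (hell : ∀ ξ : En (d + 1), lam * ‖ξ‖ ^ (2 * m) ≤ sgnQ m δ ξ) :
    Integrable (fun ξ : En (d + 1) => η (‖ξ‖ ^ 2) / sgnQ m δ ξ) := by
  have hc : HasCompactSupport (fun ξ : En (d + 1) => η (‖ξ‖ ^ 2)) := by
    refine HasCompactSupport.intro (isCompact_closedBall (0 : En (d + 1)) 2) fun x hx => h3 _ ?_
    have hx : 2 < ‖x‖ := by simpa using hx
    nlinarith
  have hi : Integrable (fun ξ : En (d + 1) => η (‖ξ‖ ^ 2)) :=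
    Continuous.integrable_of_hasCompactSupport (by fun_prop) hc
  refine (hi.const_mul lam⁻¹).mono' ?_ (ae_of_all _ fun ξ => ?_)
  · refine Measurable.aestronglyMeasurable ?_
    have e1 := hη.measurable
    have e2 := (sgnQ_cont (d := d) (m := m) (δ := δ)).measurable
    fun_prop
  · by_cases h : ‖ξ‖ ^ 2 ≤ 1
    · simp [h1 _ h]
    · push Not at h
      have hb : lam ≤ sgnQ m δ ξ := by
        refine le_trans ?_ (hell ξ)
        rw [pow_mul]
        exact le_mul_of_one_le_right hlam.le (one_le_pow₀ h.le)
      rw [Real.norm_of_nonneg (div_nonneg (h0 _) (hlam.le.trans hb)), ← div_eq_inv_mul]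
      exact div_le_div_of_nonneg_left (h0 _) hlam hb

open ENNReal in
theorem sgn_I3 {d m : ℕ} (hm : 2 ≤ m) (hd : 1 ≤ d) {η : ℝ → ℝ} (hη : Continuous η)
    (h0 : ∀ t, 0 ≤ η t) (h3 : ∀ t, 3 ≤ t → η t = 0) (h1 : ∀ t, t ≤ 1 → η t = 0)
    (h2 : ∀ t, 3 / 2 ≤ t → t ≤ 5 / 2 → η t = 1)
    (hell : ∀ δ : ℝ, 0 < δ → ∃ lam : ℝ, 0 < lam ∧
      ∀ ξ : En (d + 1), lam * ‖ξ‖ ^ (2 * m) ≤ sgnQ m δ ξ) (C : ℝ) :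
    ∃ δ : ℝ, 0 < δ ∧ C < ∫ ξ : En (d + 1), η (‖ξ‖ ^ 2) / sgnQ m δ ξ := by
  set B : Set (En (d + 1)) :=
    {x | |x 0 - 1| < 1 / 20} ∩ {x | |Real.sqrt (sgnR x) - 1| < 1 / 20} with hB
  have hBo : IsOpen B := by
    have := sgnR_cont (d := d)
    refine IsOpen.inter (isOpen_lt (by fun_prop) continuous_const)
      (isOpen_lt ?_ continuous_const)
    exact ((Real.continuous_sqrt.comp this).sub continuous_const).abs
  have hBne : B.Nonempty := by
    refine ⟨WithLp.toLp 2 (Fin.cons 1 (fun i : Fin d => if i = ⟨0, hd⟩ then 1 else 0)), ?_, ?_⟩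
    · simp
    · simp [sgnR]
  have hBpos : 0 < volume B := hBo.measure_pos volume hBne
  have main : ∀ N : ℕ, 20 ≤ N → volume.real B * N ≤ (18 * 2 ^ m) *
      ∫ ξ : En (d + 1), η (‖ξ‖ ^ 2) / sgnQ m (1 / (N : ℝ) ^ 2) ξ ∧ volume B ≠ ∞ := by
    intro N hN
    have hNr : (20 : ℝ) ≤ N := by exact_mod_cast hN
    have hδ : (0 : ℝ) < 1 / (N : ℝ) ^ 2 := by positivity
    obtain ⟨lam, hlam, hel⟩ := hell _ hδ
    have hint := sgn_I2 hη h0 h3 h1 hlam hel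
    have hnn : ∀ ξ : En (d + 1), 0 ≤ η (‖ξ‖ ^ 2) / sgnQ m (1 / (N : ℝ) ^ 2) ξ := fun ξ =>
      div_nonneg (h0 _) (le_trans (by positivity) (hel ξ))
    set ε : ℝ := (N : ℝ) ^ 2 / (6 * 2 ^ m) with hε
    have hεpos : 0 < ε := by positivity
    set S : Set (En (d + 1)) := {x | ε ≤ η (‖x‖ ^ 2) / sgnQ m (1 / (N : ℝ) ^ 2) x} with hS
    have hSfin : volume S < ∞ := hint.measure_ge_lt_top hεpos
    have hmk : ε * volume.real S ≤ ∫ ξ : En (d + 1), η (‖ξ‖ ^ 2) / sgnQ m (1 / (N : ℝ) ^ 2) ξ :=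
      mul_meas_ge_le_integral_of_nonneg (ae_of_all _ hnn) hint ε
    set e0 : En (d + 1) := EuclideanSpace.single 0 1 with he0
    have hcov : B ⊆ ⋃ j ∈ Finset.Icc (-(N : ℤ)) N, (fun x => x + ((j : ℝ) / N) • e0) ⁻¹' S := by
      intro x hx
      obtain ⟨hx0, hxR⟩ := hx
      simp only [Set.mem_setOf_eq] at hx0 hxR
      obtain ⟨p1, p2⟩ := abs_lt.1 hx0
      obtain ⟨q1, q2⟩ := abs_lt.1 hxR
      set s : ℝ := (Real.sqrt (sgnR x) - x 0) * N with hs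
      have s1 : s ≤ N := by nlinarith
      have s2 : -N ≤ s := by nlinarith
      simp only [Set.mem_iUnion, Set.mem_preimage, Finset.mem_Icc]
      refine ⟨⌊s⌋, ⟨Int.le_floor.2 (by push_cast; exact s2),
        by exact_mod_cast (Int.floor_le s).trans s1⟩, ?_⟩
      have hRe : sgnR (x + ((⌊s⌋ : ℝ) / N) • e0) = sgnR x := by
        simp [sgnR, he0]
      have h0e : (x + ((⌊s⌋ : ℝ) / N) • e0) 0 = x 0 + (⌊s⌋ : ℝ) / N := by
        simp [he0]
      refine sgn_I1 hm h2 hNr _ (by rw [hRe]; exact hxR) ?_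
      rw [hRe, h0e]
      have f1 := Int.floor_le s
      have f2 := Int.lt_floor_add_one s
      have hN0 : (0 : ℝ) < N := by linarith
      have e : Real.sqrt (sgnR x) - (x 0 + (⌊s⌋ : ℝ) / N) = (s - ⌊s⌋) / N := by
        rw [hs]; field_simp; ring
      rw [e, abs_of_nonneg (div_nonneg (by linarith) hN0.le)]
      gcongr
      linarith
    have hvol : volume B ≤ ((2 * N + 1 : ℕ) : ℝ≥0∞) * volume S := by
      calc volume B ≤ volume (⋃ j ∈ Finset.Icc (-(N : ℤ)) N,
              (fun x => x + ((j : ℝ) / N) • e0) ⁻¹' S) := measure_mono hcov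
        _ ≤ ∑ j ∈ Finset.Icc (-(N : ℤ)) N, volume ((fun x => x + ((j : ℝ) / N) • e0) ⁻¹' S) :=
            measure_biUnion_finset_le _ _
        _ = ∑ j ∈ Finset.Icc (-(N : ℤ)) N, volume S :=
            Finset.sum_congr rfl fun j _ => measure_preimage_add_right _ _ _
        _ = _ := by
            rw [Finset.sum_const, Int.card_Icc, nsmul_eq_mul]
            congr 2
            omega
    have hfin : ((2 * N + 1 : ℕ) : ℝ≥0∞) * volume S ≠ ∞ :=
      ENNReal.mul_ne_top (ENNReal.natCast_ne_top _) hSfin.ne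
    refine ⟨?_, ne_top_of_le_ne_top hfin hvol⟩
    have hvr : volume.real B ≤ (2 * N + 1 : ℝ) * volume.real S := by
      have := ENNReal.toReal_mono hfin hvol
      rw [ENNReal.toReal_mul, ENNReal.toReal_natCast] at this
      push_cast at this
      exact this
    have hS0 : 0 ≤ volume.real S := measureReal_nonneg
    calc volume.real B * N ≤ ((2 * N + 1 : ℝ) * volume.real S) * N := by gcongr
      _ ≤ (3 * N * volume.real S) * N := by gcongr; linarith
      _ = (18 * 2 ^ m) * (ε * volume.real S) := by
          rw [hε]; field_simp; ring
      _ ≤ _ := by gcongr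
  have hfinB := (main 20 le_rfl).2
  have hBr : 0 < volume.real B := ENNReal.toReal_pos hBpos.ne' hfinB
  obtain ⟨N, hN⟩ := exists_nat_gt ((18 * 2 ^ m) * C / volume.real B)
  have hN' : (18 * 2 ^ m) * C / volume.real B < (max N 20 : ℕ) :=
    hN.trans_le (by exact_mod_cast le_max_left N 20)
  have h20 : 20 ≤ max N 20 := le_max_right _ _
  have hm1 := (main _ h20).1
  refine ⟨1 / ((max N 20 : ℕ) : ℝ) ^ 2, by positivity, ?_⟩
  rw [div_lt_iff₀ hBr, mul_comm _ (volume.real B)] at hN'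
  exact lt_of_mul_lt_mul_left (hN'.trans_le hm1) (by positivity)


/-- For every m ≥ 2 and every n ≥ 2m+2 there is a uniformly elliptic
constant-coefficient operator of order 2m whose (2m−n)-homogeneous fundamental
solutions all change sign. -/
theorem stmt19 (m n : ℕ) (hm : 2 ≤ m) (hn : 2*m + 2 ≤ n) :
    ∃ A : (Fin (2*m) → Fin n) → ℝ, ∃ lam : ℝ, 0 < lam ∧
      (∀ ξ : En n, lam * ‖ξ‖^(2*m) ≤ symbolQ n m A ξ) ∧
      ∀ K : En n → ℝ,
        LocallyIntegrable K volume →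
        ContinuousOn K {(0 : En n)}ᶜ →
        HomogeneousDeg n ((2*m : ℝ) - n) K →
        IsFundamentalSolution n m A K →
        (∃ y : En n, y ≠ 0 ∧ 0 < K y) ∧ (∃ z : En n, z ≠ 0 ∧ K z < 0) := by
  obtain ⟨d, rfl⟩ : ∃ d, n = d + 1 := ⟨n - 1, by omega⟩
  let b : ContDiffBump (2 : ℝ) := ⟨1 / 2, 1, by norm_num, by norm_num⟩
  have hη : ContDiff ℝ (⊤ : ℕ∞) (fun t => b t) := b.contDiff
  have hηc : Continuous (fun t => b t) := b.continuous
  have h0 : ∀ t, 0 ≤ b t := fun t => b.nonneg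
  have hle : ∀ t, b t ≤ 1 := fun t => b.le_one
  have h3 : ∀ t, 3 ≤ t → b t = 0 := fun t ht => b.zero_of_le_dist (by
    rw [Real.dist_eq]; exact le_trans (by change (1 : ℝ) ≤ t - 2; linarith) (le_abs_self _))
  have h1 : ∀ t, t ≤ 1 → b t = 0 := fun t ht => b.zero_of_le_dist (by
    rw [Real.dist_eq]; exact le_trans (by change (1 : ℝ) ≤ -(t - 2); linarith) (neg_le_abs _))
  have h2 : ∀ t, 3 / 2 ≤ t → t ≤ 5 / 2 → b t = 1 := fun t ht ht' =>
    b.one_of_mem_closedBall (by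
      rw [Metric.mem_closedBall, Real.dist_eq]
      change _ ≤ (1 / 2 : ℝ)
      rw [abs_le]; constructor <;> linarith)
  have hell : ∀ δ : ℝ, 0 < δ → ∃ lam : ℝ, 0 < lam ∧
      ∀ ξ : En (d + 1), lam * ‖ξ‖ ^ (2 * m) ≤ sgnQ m δ ξ := by
    intro δ hδ
    obtain ⟨A, hA⟩ := sgnQ_rep (d := d) hm δ
    obtain ⟨lam, hlam, h⟩ := sgn_ellip (n := d + 1) (m := m) (A := A) (by omega) (by omega)
      (fun ξ hξ => by rw [hA]; exact sgnQ_pos hδ ξ hξ)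
    exact ⟨lam, hlam, fun ξ => by rw [← hA]; exact h ξ⟩
  obtain ⟨δ, hδ, hC⟩ := sgn_I3 (d := d) hm (by omega) hηc h0 h3 h1 h2 hell
    (max 0 (∫ ζ : En (d + 1), b (‖ζ‖ ^ 2) / sgnR ζ ^ m))
  obtain ⟨A, hA⟩ := sgnQ_rep (d := d) hm δ
  obtain ⟨lam, hlam, hl⟩ := hell δ hδ
  refine ⟨A, lam, hlam, fun ξ => by rw [hA]; exact hl ξ, ?_⟩
  intro K hloc hc hh hf
  have hnR : (2 * m + 2 : ℝ) ≤ ((d + 1 : ℕ) : ℝ) := by exact_mod_cast hn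
  obtain ⟨C, -, hCb⟩ := sgn_Kbdd (by linarith) hc hh
  have hK := sgn_Kint hloc hCb
  have hhom : ∀ s : ℝ, 0 < s → ∀ x : En (d + 1), x ≠ 0 →
      K x = s ^ (d + 1 - 2 * m) * K (s • x) := by
    intro s hs x hx
    rw [hh s hs.ne' x hx, abs_of_pos hs, ← mul_assoc, ← Real.rpow_natCast, ← Real.rpow_add hs,
      Nat.cast_sub (by omega)]
    push_cast
    have : (d : ℝ) + 1 - 2 * m + (2 * m - (d + 1)) = 0 := by ring
    rw [this, Real.rpow_zero, one_mul]
  obtain ⟨hs1, hs2⟩ := sgn_sign (p := d + 1 - 2 * m) (by omega) (by omega)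
    (fun ξ hξ => by rw [hA]; exact sgnQ_pos hδ ξ hξ) hloc hK hhom hf hη h0 h3 h1
  simp only [hA] at hs1 hs2
  constructor
  · by_contra! hcon
    have := hs1 hcon
    exact absurd (lt_of_le_of_lt (le_max_left _ _) hC) (not_lt.2 this)
  · by_contra! hcon
    have h := hs2 hcon
    have := sgn_H2 hm (by omega) hηc h0 hle h3 hlam hl
      (fun ε hε hε1 => h (sgnM d ε hε) (sgnM_symm hε) (sgnM_norm hε hε1))
    exact absurd (lt_of_le_of_lt (le_max_right _ _) hC) (not_lt.2 this)
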